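/- Let L₁ be any one of the unimodal logics Log⟨ω,<⟩, GL.3, or DisK4.3. Then the commutator [L₁, Diff] is Kripke incomplete: there is no class C of 2-frames such that [L₁, Diff] equals the set of bimodal formulas valid in every member of C. -/

import Mathlib

namespace HK

/-! ## Bimodal formulas -/

/-- Bimodal formulas: `φ ::= P | ¬φ | φ∧ψ | ◇₀φ | ◇₁φ`. -/
inductive BForm : Type
  | var : ℕ → BForm
  | neg : BForm → BForm
  | and : BForm → BForm → BForm
  | dia0 : BForm → BForm
  | dia1 : BForm → BForm

namespace BForm

def imp (φ ψ : BForm) : BForm := neg (and φ (neg ψ))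
def bot : BForm := and (var 0) (neg (var 0))
def top : BForm := neg bot
def box0 (φ : BForm) : BForm := neg (dia0 (neg φ))
def box1 (φ : BForm) : BForm := neg (dia1 (neg φ))
/-- `□₀⁺φ := φ ∧ □₀φ` -/
def boxP0 (φ : BForm) : BForm := and φ (box0 φ)
/-- `□₁⁺φ := φ ∧ □₁φ` -/
def boxP1 (φ : BForm) : BForm := and φ (box1 φ)

/-- Modal nesting depth. -/
def depth : BForm → ℕ
  | var _ => 0
  | neg φ => depth φ
  | and φ ψ => max (depth φ) (depth ψ)
  | dia0 φ => depth φ + 1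
  | dia1 φ => depth φ + 1

/-- The propositional variable `k` occurs in the formula. -/
def Occurs (k : ℕ) : BForm → Prop
  | var n => k = n
  | neg φ => Occurs k φ
  | and φ ψ => Occurs k φ ∨ Occurs k ψ
  | dia0 φ => Occurs k φ
  | dia1 φ => Occurs k φ

/-- The formula uses only the modal operator `◇₀`. -/
def OnlyDia0 : BForm → Prop
  | var _ => True
  | neg φ => OnlyDia0 φ
  | and φ ψ => OnlyDia0 φ ∧ OnlyDia0 ψ
  | dia0 φ => OnlyDia0 φ
  | dia1 _ => False

/-- The formula uses only the modal operator `◇₁`. -/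
def OnlyDia1 : BForm → Prop
  | var _ => True
  | neg φ => OnlyDia1 φ
  | and φ ψ => OnlyDia1 φ ∧ OnlyDia1 ψ
  | dia0 _ => False
  | dia1 φ => OnlyDia1 φ

/-- Relativisation `φ^D` of each diamond to the variable `d`:
each subformula `◇ᵢψ` is replaced by `◇ᵢ(D ∧ ψ^D)`. -/
def relativize (d : ℕ) : BForm → BForm
  | var n => var n
  | neg φ => neg (relativize d φ)
  | and φ ψ => and (relativize d φ) (relativize d ψ)
  | dia0 φ => dia0 (and (var d) (relativize d φ))
  | dia1 φ => dia1 (and (var d) (relativize d φ))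

/-- `□₀^k φ` -/
def iterBox0 : ℕ → BForm → BForm
  | 0, φ => φ
  | n+1, φ => box0 (iterBox0 n φ)

/-- `□₁^k φ` -/
def iterBox1 : ℕ → BForm → BForm
  | 0, φ => φ
  | n+1, φ => box1 (iterBox1 n φ)

/-- `□₀^{≤n} φ := ⋀_{k ≤ n} □₀^k φ` -/
def boxLe0 : ℕ → BForm → BForm
  | 0, φ => φ
  | n+1, φ => and (boxLe0 n φ) (iterBox0 (n+1) φ)

/-- `□₁^{≤n} φ := ⋀_{k ≤ n} □₁^k φ` -/
def boxLe1 : ℕ → BForm → BForm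
  | 0, φ => φ
  | n+1, φ => and (boxLe1 n φ) (iterBox1 (n+1) φ)

/-- Uniform substitution. -/
def subst (s : ℕ → BForm) : BForm → BForm
  | var n => s n
  | neg φ => neg (subst s φ)
  | and φ ψ => and (subst s φ) (subst s ψ)
  | dia0 φ => dia0 (subst s φ)
  | dia1 φ => dia1 (subst s φ)

end BForm

/-- Kripke truth over a 2-frame `⟨W, R0, R1⟩` with valuation `val`. -/
def BSat {W : Type} (R0 R1 : W → W → Prop) (val : ℕ → W → Prop) : W → BForm → Prop
  | w, .var n => val n w
  | w, .neg φ => ¬ BSat R0 R1 val w φ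
  | w, .and φ ψ => BSat R0 R1 val w φ ∧ BSat R0 R1 val w ψ
  | w, .dia0 φ => ∃ v, R0 w v ∧ BSat R0 R1 val v φ
  | w, .dia1 φ => ∃ v, R1 w v ∧ BSat R0 R1 val v φ

/-! ## Frames -/

/-- A (unimodal) frame: a nonempty set with a binary relation. -/
structure Frame : Type 1 where
  W : Type
  R : W → W → Prop
  ne : Nonempty W

/-- A 2-frame: a nonempty set with two binary relations. -/
structure Frame2 : Type 1 where
  W : Type
  R0 : W → W → Prop
  R1 : W → W → Prop
  ne : Nonempty W

/-- Validity of a bimodal formula in a 2-frame. -/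
def Frame2.Valid (F : Frame2) (φ : BForm) : Prop :=
  ∀ (val : ℕ → F.W → Prop) (w : F.W), BSat F.R0 F.R1 val w φ

/-- Satisfaction of a bimodal formula in some model based on the 2-frame. -/
def Frame2.Sat (F : Frame2) (φ : BForm) : Prop :=
  ∃ (val : ℕ → F.W → Prop) (w : F.W), BSat F.R0 F.R1 val w φ

/-- Horizontal relation of a product frame. -/
def prodR0 {A B : Type} (R : A → A → Prop) : A × B → A × B → Prop :=
  fun p q => R p.1 q.1 ∧ p.2 = q.2

/-- Vertical relation of a product frame. -/
def prodR1 {A B : Type} (S : B → B → Prop) : A × B → A × B → Prop :=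
  fun p q => p.1 = q.1 ∧ S p.2 q.2

/-- `φ` is satisfied in some model based on the product frame `⟨A,R⟩ × ⟨B,S⟩`. -/
def ProdSat {A B : Type} (R : A → A → Prop) (S : B → B → Prop) (φ : BForm) : Prop :=
  ∃ (val : ℕ → A × B → Prop) (w : A × B), BSat (prodR0 R) (prodR1 S) val w φ

/-- `φ` is valid in the product frame `⟨A,R⟩ × ⟨B,S⟩`. -/
def ProdValid {A B : Type} (R : A → A → Prop) (S : B → B → Prop) (φ : BForm) : Prop :=
  ∀ (val : ℕ → A × B → Prop) (w : A × B), BSat (prodR0 R) (prodR1 S) val w φ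

/-- The product 2-frame of two frames. -/
def prodFrame2 (A B : Type) [Nonempty A] [Nonempty B]
    (R : A → A → Prop) (S : B → B → Prop) : Frame2 :=
  ⟨A × B, prodR0 R, prodR1 S, inferInstance⟩

/-- Linear order: irreflexive, transitive and trichotomous. -/
def IsLin {T : Type} (R : T → T → Prop) : Prop :=
  (∀ x, ¬ R x x) ∧ (∀ x y z, R x y → R y z → R x z) ∧ (∀ x y, R x y ∨ x = y ∨ R y x)

/-- Weak order: transitive and weakly connected. -/
def WeakOrd {T : Type} (R : T → T → Prop) : Prop :=
  (∀ x y z, R x y → R y z → R x z) ∧ (∀ x y z, R x y → R x z → y = z ∨ R y z ∨ R z y)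

/-- Modal discreteness. -/
def ModallyDiscrete {T : Type} (R : T → T → Prop) : Prop :=
  ¬ ∃ (x : ℕ → T) (xω : T), (∀ i, R (x i) (x (i+1))) ∧ (∀ i, x i ≠ x (i+1)) ∧
      (∀ i, R (x i) xω) ∧ (∀ i, ¬ R xω (x i))

/-- No infinite ascending chains of distinct points. -/
def Noetherian {T : Type} (R : T → T → Prop) : Prop :=
  ¬ ∃ x : ℕ → T, (∀ i, R (x i) (x (i+1))) ∧ (∀ i, x i ≠ x (i+1))

/-- The frame is (isomorphic to) `⟨ω,<⟩`. -/
def IsOmegaFrame (F : Frame) : Prop :=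
  ∃ e : F.W ≃ ℕ, ∀ a b, F.R a b ↔ e a < e b

/-- The frame is a finite linear order. -/
def IsFinLinFrame (F : Frame) : Prop := Finite F.W ∧ IsLin F.R

/-- `F` contains an `⟨ω+1,>⟩`-type chain: distinct points `x₀,…,x_n,…,x_ω` with
`x_n R x_m` iff `n > m` (for `n ≠ m`). -/
def HasOmegaPlusOneChain (F : Frame) : Prop :=
  ∃ (x : ℕ → F.W) (xω : F.W), Function.Injective x ∧ (∀ n, x n ≠ xω) ∧
    (∀ n m, n ≠ m → (F.R (x n) (x m) ↔ m < n)) ∧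
    (∀ n, F.R xω (x n)) ∧ (∀ n, ¬ F.R (x n) xω)

/-! ## Two-dimensional (expanding/decreasing) 2-frames `H_{F,Ḡ}` -/

/-- A 2-frame `H_{F,Ḡ}` built from a horizontal frame `⟨H,R⟩` and, for each `x : H`,
a vertical frame `G_x = ⟨D x, S x⟩` carved out of a common ambient type `V`. -/
structure TwoFrame : Type 1 where
  H : Type
  R : H → H → Prop
  Hne : Nonempty H
  V : Type
  D : H → Set V
  S : H → V → V → Prop
  Dne : ∀ x, (D x).Nonempty

namespace TwoFrame

/-- The horizontal frame. -/
def horiz (T : TwoFrame) : Frame := ⟨T.H, T.R, T.Hne⟩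

/-- The vertical frame `G_x` at `x`. -/
def fiber (T : TwoFrame) (x : T.H) : Frame :=
  ⟨{a : T.V // a ∈ T.D x}, fun a b => T.S x a.1 b.1,
    Exists.elim (T.Dne x) (fun a ha => ⟨⟨a, ha⟩⟩)⟩

/-- The worlds `{⟨u,v⟩ : u ∈ H, v ∈ D u}`. -/
def Worlds (T : TwoFrame) : Type := {p : T.H × T.V // p.2 ∈ T.D p.1}

/-- Horizontal relation of `H_{F,Ḡ}`. -/
def Rh (T : TwoFrame) : T.Worlds → T.Worlds → Prop :=
  fun p q => T.R p.1.1 q.1.1 ∧ p.1.2 = q.1.2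

/-- Vertical relation of `H_{F,Ḡ}`. -/
def Rv (T : TwoFrame) : T.Worlds → T.Worlds → Prop :=
  fun p q => p.1.1 = q.1.1 ∧ T.S p.1.1 p.1.2 q.1.2

/-- `φ` is satisfied in some model based on `H_{F,Ḡ}`. -/
def Sat (T : TwoFrame) (φ : BForm) : Prop :=
  ∃ (val : ℕ → T.Worlds → Prop) (w : T.Worlds), BSat T.Rh T.Rv val w φ

/-- Decreasing 2-frame: `G_y` is a subframe of `G_x` whenever `x R y`. -/
def Decreasing (T : TwoFrame) : Prop :=
  ∀ x y, T.R x y → T.D y ⊆ T.D x ∧ ∀ a ∈ T.D y, ∀ b ∈ T.D y, (T.S y a b ↔ T.S x a b)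

/-- Expanding 2-frame: `G_x` is a subframe of `G_y` whenever `x R y`. -/
def Expanding (T : TwoFrame) : Prop :=
  ∀ x y, T.R x y → T.D x ⊆ T.D y ∧ ∀ a ∈ T.D x, ∀ b ∈ T.D x, (T.S x a b ↔ T.S y a b)

/-- All vertical frames are difference frames. -/
def DiffFibers (T : TwoFrame) : Prop :=
  ∀ x, ∀ a ∈ T.D x, ∀ b ∈ T.D x, (T.S x a b ↔ a ≠ b)

end TwoFrame

/-- `φ` is satisfied in some model based on a product of a member of `C`
with a difference frame. -/
def ProdDiffSat (C : Frame → Prop) (φ : BForm) : Prop :=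
  ∃ F : Frame, C F ∧ ∃ D : Type, Nonempty D ∧ ProdSat F.R (fun a b : D => a ≠ b) φ

/-- `φ` is satisfied in some model based on a decreasing 2-frame with horizontal
frame in `C` and all vertical frames difference frames. -/
def DecDiffSat (C : Frame → Prop) (φ : BForm) : Prop :=
  ∃ T : TwoFrame, C T.horiz ∧ T.Decreasing ∧ T.DiffFibers ∧ T.Sat φ

/-- `φ` is satisfied in some model based on an expanding 2-frame with horizontal
frame in `C` and all vertical frames difference frames. -/
def ExpDiffSat (C : Frame → Prop) (φ : BForm) : Prop :=
  ∃ T : TwoFrame, C T.horiz ∧ T.Expanding ∧ T.DiffFibers ∧ T.Sat φ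

/-- `φ` is satisfied in some model based on a product of a member of `C0` with a
member of `C1`. -/
def ProdClassSat (C0 C1 : Frame → Prop) (φ : BForm) : Prop :=
  ∃ F0, C0 F0 ∧ ∃ F1, C1 F1 ∧ ProdSat F0.R F1.R φ

/-- `φ` is satisfied in some model based on a decreasing 2-frame with horizontal
frame in `C0` and all vertical frames in `C1`. -/
def DecClassSat (C0 C1 : Frame → Prop) (φ : BForm) : Prop :=
  ∃ T : TwoFrame, C0 T.horiz ∧ (∀ x, C1 (T.fiber x)) ∧ T.Decreasing ∧ T.Sat φ

/-- `φ` is satisfied in some model based on an expanding 2-frame with horizontal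
frame in `C0` and all vertical frames in `C1`. -/
def ExpClassSat (C0 C1 : Frame → Prop) (φ : BForm) : Prop :=
  ∃ T : TwoFrame, C0 T.horiz ∧ (∀ x, C1 (T.fiber x)) ∧ T.Expanding ∧ T.Sat φ

/-- Satisfiability over products of `⟨ω,<⟩` with difference frames. -/
def OmegaDiffSat (φ : BForm) : Prop :=
  ∃ D : Type, Nonempty D ∧ ProdSat (fun m n : ℕ => m < n) (fun a b : D => a ≠ b) φ

/-- Satisfiability over products of finite linear orders with difference frames. -/
def FinLinDiffSat (φ : BForm) : Prop :=
  ∃ (T : Type) (R : T → T → Prop), Finite T ∧ IsLin R ∧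
    ∃ D : Type, Nonempty D ∧ ProdSat R (fun a b : D => a ≠ b) φ

/-! ## Bimodal logics -/

/-- Propositional tautology (diamond formulas treated as atoms). -/
def IsTaut (φ : BForm) : Prop :=
  ∀ v : BForm → Prop, (∀ ψ, v (BForm.neg ψ) ↔ ¬ v ψ) →
    (∀ ψ χ, v (BForm.and ψ χ) ↔ v ψ ∧ v χ) → v φ

/-- Normal bimodal logic. -/
structure IsLogic (L : Set BForm) : Prop where
  taut : ∀ φ, IsTaut φ → φ ∈ L
  K0 : BForm.imp (BForm.box0 (BForm.imp (BForm.var 0) (BForm.var 1)))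
        (BForm.imp (BForm.box0 (BForm.var 0)) (BForm.box0 (BForm.var 1))) ∈ L
  K1 : BForm.imp (BForm.box1 (BForm.imp (BForm.var 0) (BForm.var 1)))
        (BForm.imp (BForm.box1 (BForm.var 0)) (BForm.box1 (BForm.var 1))) ∈ L
  mp : ∀ φ ψ, BForm.imp φ ψ ∈ L → φ ∈ L → ψ ∈ L
  subst : ∀ φ s, φ ∈ L → BForm.subst s φ ∈ L
  nec0 : ∀ φ, φ ∈ L → BForm.box0 φ ∈ L
  nec1 : ∀ φ, φ ∈ L → BForm.box1 φ ∈ L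

/-- Validity of a (◇₀-)formula in a unimodal frame `⟨W,R⟩`. -/
def UValid0 {W : Type} (R : W → W → Prop) (φ : BForm) : Prop :=
  ∀ (val : ℕ → W → Prop) (w : W), BSat R (fun _ _ => False) val w φ

/-- Validity of a (◇₁-)formula in a unimodal frame `⟨W,S⟩`. -/
def UValid1 {W : Type} (S : W → W → Prop) (φ : BForm) : Prop :=
  ∀ (val : ℕ → W → Prop) (w : W), BSat (fun _ _ => False) S val w φ

/-- `K4.3`: the unimodal logic (in `◇₀`) of all linear orders. -/
def K43 : Set BForm :=
  {φ | φ.OnlyDia0 ∧ ∀ (T : Type) (R : T → T → Prop), Nonempty T → IsLin R → UValid0 R φ}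

/-- `Diff`: the unimodal logic (in `◇₁`) of all difference frames. -/
def DiffLogic : Set BForm :=
  {φ | φ.OnlyDia1 ∧ ∀ (D : Type), Nonempty D → UValid1 (fun a b : D => a ≠ b) φ}

/-- `Log⟨ω,<⟩`: the unimodal logic (in `◇₀`) of the frame `⟨ω,<⟩`. -/
def LogOmega : Set BForm :=
  {φ | φ.OnlyDia0 ∧ UValid0 (fun m n : ℕ => m < n) φ}

/-- `GL.3`: the unimodal logic (in `◇₀`) of all Noetherian irreflexive linear orders. -/
def GL3 : Set BForm :=
  {φ | φ.OnlyDia0 ∧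
    ∀ (T : Type) (R : T → T → Prop), Nonempty T → IsLin R → Noetherian R → UValid0 R φ}

/-- `DisK4.3`: the unimodal logic (in `◇₀`) of all modally discrete weak orders. -/
def DisK43 : Set BForm :=
  {φ | φ.OnlyDia0 ∧
    ∀ (T : Type) (R : T → T → Prop), Nonempty T → WeakOrd R → ModallyDiscrete R → UValid0 R φ}

def commAx1 : BForm :=
  BForm.imp (BForm.box1 (BForm.box0 (BForm.var 0))) (BForm.box0 (BForm.box1 (BForm.var 0)))
def commAx2 : BForm :=
  BForm.imp (BForm.box0 (BForm.box1 (BForm.var 0))) (BForm.box1 (BForm.box0 (BForm.var 0)))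
def commAx3 : BForm :=
  BForm.imp (BForm.dia0 (BForm.box1 (BForm.var 0))) (BForm.box1 (BForm.dia0 (BForm.var 0)))

/-- The commutator `[L0,L1]`: the smallest bimodal logic containing `L0`, `L1` (and
hence their fusion) together with the commutativity/confluence axioms. -/
def Commutator (L0 L1 : Set BForm) : Set BForm :=
  ⋂₀ {L : Set BForm | IsLogic L ∧ L0 ⊆ L ∧ L1 ⊆ L ∧
      commAx1 ∈ L ∧ commAx2 ∈ L ∧ commAx3 ∈ L}

/-- The product logic `L0 × L1`: the logic of all products of a frame for `L0`
with a frame for `L1`. -/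
def ProdLogic (L0 L1 : Set BForm) : Set BForm :=
  {φ | ∀ (A B : Type), Nonempty A → Nonempty B → ∀ (R : A → A → Prop) (S : B → B → Prop),
      (∀ ψ ∈ L0, UValid0 R ψ) → (∀ ψ ∈ L1, UValid1 S ψ) → ProdValid R S φ}

/-- The logic of a class of 2-frames. -/
def LogOf (C : Frame2 → Prop) : Set BForm := {φ | ∀ F, C F → F.Valid φ}

/-- Kripke completeness of a bimodal logic. -/
def KripkeComplete (L : Set BForm) : Prop := ∃ C : Frame2 → Prop, L = LogOf C

/-- `L`-satisfiability: `φ` is satisfied in some model `M` with `M ⊨ L`. -/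
def LSat (L : Set BForm) (φ : BForm) : Prop :=
  ∃ (W : Type) (_ : Nonempty W) (R0 R1 : W → W → Prop) (val : ℕ → W → Prop),
    (∀ ψ ∈ L, ∀ w, BSat R0 R1 val w ψ) ∧ ∃ w, BSat R0 R1 val w φ

/-! ## One-variable first-order temporal logic with counting (FOLTL≠) -/

/-- FOLTL≠-formulas: `φ ::= P(x) | ¬φ | φ∧ψ | ◇_F φ | ∃≠x φ`. -/
inductive TForm : Type
  | atom : ℕ → TForm
  | neg : TForm → TForm
  | and : TForm → TForm → TForm
  | diaF : TForm → TForm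
  | exNe : TForm → TForm

/-- Truth of an FOLTL≠-formula in a first-order temporal model based on the
timeline `⟨T,lt⟩` with domains `D` and interpretation `I`. -/
def TSat {T U : Type} (lt : T → T → Prop) (D : T → Set U) (I : ℕ → T → U → Prop) :
    T → U → TForm → Prop
  | t, a, .atom n => I n t a
  | t, a, .neg φ => ¬ TSat lt D I t a φ
  | t, a, .and φ ψ => TSat lt D I t a φ ∧ TSat lt D I t a ψ
  | t, a, .diaF φ => ∃ t', lt t t' ∧ a ∈ D t' ∧ TSat lt D I t' a φ
  | t, a, .exNe φ => ∃ b, b ∈ D t ∧ b ≠ a ∧ TSat lt D I t b φ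

/-- The standard translation `⋆` from FOLTL≠-formulas to bimodal formulas. -/
def TForm.star : TForm → BForm
  | .atom n => .var n
  | .neg φ => .neg (TForm.star φ)
  | .and φ ψ => .and (TForm.star φ) (TForm.star ψ)
  | .diaF φ => .dia0 (TForm.star φ)
  | .exNe φ => .dia1 (TForm.star φ)

/-- Satisfiability in constant domain models over the timeline `⟨T,lt⟩`. -/
def FOLTLConstSat {T : Type} (lt : T → T → Prop) (φ : TForm) : Prop :=
  ∃ (U : Type) (I : ℕ → T → U → Prop) (t : T) (a : U),
    TSat lt (fun _ => (Set.univ : Set U)) I t a φ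

/-- Satisfiability in decreasing domain models over the timeline `⟨T,lt⟩`. -/
def FOLTLDecSat {T : Type} (lt : T → T → Prop) (φ : TForm) : Prop :=
  ∃ (U : Type) (D : T → Set U), (∀ t, (D t).Nonempty) ∧
    (∀ t t', lt t t' → D t' ⊆ D t) ∧
    ∃ (I : ℕ → T → U → Prop) (t : T) (a : U), a ∈ D t ∧ TSat lt D I t a φ

/-- Satisfiability in expanding domain models over the timeline `⟨T,lt⟩`. -/
def FOLTLExpSat {T : Type} (lt : T → T → Prop) (φ : TForm) : Prop :=
  ∃ (U : Type) (D : T → Set U), (∀ t, (D t).Nonempty) ∧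
    (∀ t t', lt t t' → D t ⊆ D t') ∧
    ∃ (I : ℕ → T → U → Prop) (t : T) (a : U), a ∈ D t ∧ TSat lt D I t a φ

/-- Satisfiability in constant domain models over a class `C` of timelines. -/
def FOLTLConstSatC (C : Frame → Prop) (φ : TForm) : Prop :=
  ∃ F, C F ∧ FOLTLConstSat F.R φ

/-- Satisfiability in decreasing domain models over a class `C` of timelines. -/
def FOLTLDecSatC (C : Frame → Prop) (φ : TForm) : Prop :=
  ∃ F, C F ∧ FOLTLDecSat F.R φ

/-- Satisfiability in expanding domain models over a class `C` of timelines. -/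
def FOLTLExpSatC (C : Frame → Prop) (φ : TForm) : Prop :=
  ∃ F, C F ∧ FOLTLExpSat F.R φ

/-- The class of all linear orders. -/
def AllLin : Frame → Prop := fun F => IsLin F.R

/-- The class of all finite linear orders. -/
def AllFinLin : Frame → Prop := IsFinLinFrame

/-! ## Gödel numbering -/

/-- A fixed effective Gödel numbering of bimodal formulas. -/
def encodeB : BForm → ℕ
  | .var n => Nat.pair 0 n
  | .neg φ => Nat.pair 1 (encodeB φ)
  | .and φ ψ => Nat.pair 2 (Nat.pair (encodeB φ) (encodeB ψ))
  | .dia0 φ => Nat.pair 3 (encodeB φ)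
  | .dia1 φ => Nat.pair 4 (encodeB φ)

/-- A fixed effective Gödel numbering of FOLTL≠-formulas. -/
def encodeT : TForm → ℕ
  | .atom n => Nat.pair 0 n
  | .neg φ => Nat.pair 1 (encodeT φ)
  | .and φ ψ => Nat.pair 2 (Nat.pair (encodeT φ) (encodeT ψ))
  | .diaF φ => Nat.pair 3 (encodeT φ)
  | .exNe φ => Nat.pair 4 (encodeT φ)

/-- The set of codes of bimodal formulas with property `P`. -/
def BCodes (P : BForm → Prop) : ℕ → Prop := fun n => ∃ φ, encodeB φ = n ∧ P φ

/-- The set of codes of FOLTL≠-formulas with property `P`. -/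
def TCodes (P : TForm → Prop) : ℕ → Prop := fun n => ∃ φ, encodeT φ = n ∧ P φ

/-! ## The analytical hierarchy: Σ₁¹ -/

/-- `A ⊆ ℕ` is `Σ₁¹`: in normal form `n ∈ A ↔ ∃ f : ℕ → ℕ, ∀ m, R (n, f̄(m))`
for a computable predicate `R` of the number `n` and finite initial segments of `f`. -/
def Sigma11 (A : ℕ → Prop) : Prop :=
  ∃ R : ℕ × List ℕ → Prop, ComputablePred R ∧
    ∀ n, A n ↔ ∃ f : ℕ → ℕ, ∀ m, R (n, (List.range m).map f)

/-- `Σ₁¹`-hardness with respect to computable many-one reducibility. -/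
def Sigma11Hard (A : ℕ → Prop) : Prop := ∀ B : ℕ → Prop, Sigma11 B → ManyOneReducible B A

/-- `Σ₁¹`-completeness. -/
def Sigma11Complete (A : ℕ → Prop) : Prop := Sigma11 A ∧ Sigma11Hard A

/-! ## Counter (Minsky) machines -/

/-- Counter machine operations: `inl i` increments counter `i`, `inr (inl i)`
decrements counter `i`, `inr (inr i)` zero-tests counter `i`. -/
abbrev CMOp : Type := ℕ ⊕ ℕ ⊕ ℕ

def CMOp.counter : CMOp → ℕ
  | Sum.inl i => i
  | Sum.inr (Sum.inl i) => i
  | Sum.inr (Sum.inr i) => i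

/-- Description of a counter machine: number `N` of counters, number of states
(states are `0,…,states-1`), list of terminal states, and list of instructions
`(q, op, q')`. -/
abbrev CMDesc : Type := ℕ × ℕ × List ℕ × List (ℕ × CMOp × ℕ)

/-- Well-formedness of a counter machine description: `N > 1`, terminal states are
states, instructions are attached to non-terminal states and mention genuine
counters, and every non-terminal state has at least one instruction. -/
def CMWF (M : CMDesc) : Prop :=
  1 < M.1 ∧ (∀ q ∈ M.2.2.1, q < M.2.1) ∧
  (∀ t ∈ M.2.2.2, t.1 < M.2.1 ∧ t.1 ∉ M.2.2.1 ∧ t.2.2 < M.2.1 ∧ CMOp.counter t.2.1 < M.1) ∧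
  (∀ q, q < M.2.1 → q ∉ M.2.2.1 → ∃ t ∈ M.2.2.2, t.1 = q)

/-- A configuration: current state and contents of the counters. -/
abbrev CMConfig : Type := ℕ × (ℕ → ℕ)

/-- Reliable step of a counter machine. -/
def CMStep (M : CMDesc) (σ σ' : CMConfig) : Prop :=
  ∃ op q', (σ.1, op, q') ∈ M.2.2.2 ∧ σ'.1 = q' ∧
    match op with
    | Sum.inl i => σ'.2 i = σ.2 i + 1 ∧ ∀ j, j ≠ i → σ'.2 j = σ.2 j
    | Sum.inr (Sum.inl i) => 0 < σ.2 i ∧ σ'.2 i + 1 = σ.2 i ∧ ∀ j, j ≠ i → σ'.2 j = σ.2 j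
    | Sum.inr (Sum.inr i) => σ.2 i = 0 ∧ ∀ j, σ'.2 j = σ.2 j

/-- Lossy step of a counter machine. -/
def CMStepLossy (M : CMDesc) (σ σ' : CMConfig) : Prop :=
  ∃ c1 c2 : ℕ → ℕ, CMStep M (σ.1, c1) (σ'.1, c2) ∧ (∀ i, c1 i ≤ σ.2 i) ∧ (∀ i, σ'.2 i ≤ c2 i)

/-- The configuration `⟨q, 𝟎⟩` with all-0 counters. -/
def zeroConfig (q : ℕ) : CMConfig := (q, fun _ => 0)

/-- CM non-termination: the machine has an infinite run starting with `⟨q₀,𝟎⟩`. -/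
def CMNonTerm : CMDesc × ℕ → Prop := fun p =>
  CMWF p.1 ∧ ∃ ρ : ℕ → CMConfig, ρ 0 = zeroConfig p.2 ∧ ∀ n, CMStep p.1 (ρ n) (ρ (n+1))

/-- CM reachability: the machine has a run starting with `⟨q₀,𝟎⟩` reaching `q_r`. -/
def CMReach : CMDesc × ℕ × ℕ → Prop := fun p =>
  CMWF p.1 ∧ ∃ (B : ℕ) (ρ : ℕ → CMConfig), ρ 0 = zeroConfig p.2.1 ∧
    (∀ n, n < B → CMStep p.1 (ρ n) (ρ (n+1))) ∧ (ρ B).1 = p.2.2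

/-- CM recurrence: the machine has an infinite run starting with `⟨q₀,𝟎⟩`
visiting `q_r` infinitely often. -/
def CMRecur : CMDesc × ℕ × ℕ → Prop := fun p =>
  CMWF p.1 ∧ ∃ ρ : ℕ → CMConfig, ρ 0 = zeroConfig p.2.1 ∧
    (∀ n, CMStep p.1 (ρ n) (ρ (n+1))) ∧ ∀ n, ∃ m, n ≤ m ∧ (ρ m).1 = p.2.2

/-- LCM reachability: the machine has a lossy run starting with `⟨q₀,𝟎⟩`
reaching `q_r`. -/
def LCMReach : CMDesc × ℕ × ℕ → Prop := fun p =>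
  CMWF p.1 ∧ ∃ (B : ℕ) (ρ : ℕ → CMConfig), ρ 0 = zeroConfig p.2.1 ∧
    (∀ n, n < B → CMStepLossy p.1 (ρ n) (ρ (n+1))) ∧ (ρ B).1 = p.2.2

/-- LCM ω-reachability: for every `k`, the machine has a lossy run starting with
`⟨q₀,𝟎⟩` visiting `q_r` at least `k` times. -/
def LCMOmegaReach : CMDesc × ℕ × ℕ → Prop := fun p =>
  CMWF p.1 ∧ ∀ k : ℕ, ∃ (B : ℕ) (ρ : ℕ → CMConfig), ρ 0 = zeroConfig p.2.1 ∧
    (∀ n, n < B → CMStepLossy p.1 (ρ n) (ρ (n+1))) ∧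
    k ≤ ((Finset.range (B+1)).filter (fun n => (ρ n).1 = p.2.2)).card

/-! ## Particular formulas used in the statements -/

/-- `□₁⁺□₀⁺(◇₀⊤ → □₁◇₀⊤) ∧ φ` (Prop. 2.4 of the paper). -/
def diffDecForm (φ : BForm) : BForm :=
  BForm.and
    (BForm.boxP1 (BForm.boxP0
      (BForm.imp (BForm.dia0 BForm.top) (BForm.box1 (BForm.dia0 BForm.top))))) φ

/-- `D ∧ □₀^{≤n}□₁^{≤n}(◇₀D → D) ∧ φ^D`. -/
def decRelForm (d n : ℕ) (φ : BForm) : BForm :=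
  BForm.and (BForm.var d)
    (BForm.and
      (BForm.boxLe0 n (BForm.boxLe1 n
        (BForm.imp (BForm.dia0 (BForm.var d)) (BForm.var d))))
      (BForm.relativize d φ))

/-- `D ∧ □₀^{≤n}□₁^{≤n}(D → □₀D) ∧ φ^D`. -/
def expRelForm (d n : ℕ) (φ : BForm) : BForm :=
  BForm.and (BForm.var d)
    (BForm.and
      (BForm.boxLe0 n (BForm.boxLe1 n
        (BForm.imp (BForm.var d) (BForm.box0 (BForm.var d)))))
      (BForm.relativize d φ))



theorem kripke_core {W : Type} (R0 E : W → W → Prop)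
    (rfl' : ∀ x, E x x) (sym : ∀ x y, E x y → E y x) (tr : ∀ x y z, E x y → E y z → E x z)
    (trans : ∀ x y z, R0 x y → R0 y z → R0 x z)
    (wc : ∀ x y z, R0 x y → R0 x z → y = z ∨ R0 y z ∨ R0 z y)
    (alpha : ∀ S : Set W, (∀ a ∈ S, ∃ g, g ∉ S ∧ R0 a g ∧ ∃ a' ∈ S, R0 g a') →
      ∀ b ∈ S, ∀ z, R0 b z → ∃ s ∈ S, R0 z s)
    (comm1 : ∀ w x y, R0 w x → E x y → ∃ u, E w u ∧ R0 u y)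
    (comm2 : ∀ a b c, E a b → R0 b c → ∃ d, R0 a d ∧ E d c)
    (p r l : W → Prop) (P Lc : W → Prop)
    (hP : ∀ x, P x ↔ ∃ y, E x y ∧ p y) (hL : ∀ x, Lc x ↔ ∃ y, E x y ∧ l y)
    (w : W) (D : W → Prop) (hD : ∀ x, D x ↔ E w x ∨ ∃ y, R0 w y ∧ E y x)
    (ha : P w)
    (hb : ∃ y, R0 w y ∧ Lc y)
    (hc : ∃ z, R0 w z ∧ ¬ P z ∧ ¬ Lc z ∧ (∀ y, R0 z y → ¬ P y) ∧ ∀ y, R0 z y → ¬ Lc y)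
    (hd : ∀ x y, D x → p x → p y → E x y → x = y)
    (he : ∀ x y, D x → l x → R0 x y → ¬ l y)
    (hf : ∀ x, D x → p x → (∃ y, R0 x y ∧ P y) →
      ∃ g, R0 x g ∧ ¬ P g ∧ ∃ ρ, R0 g ρ ∧ r ρ ∧ P ρ)
    (hh : ∀ x, D x → p x → ∀ y, R0 x y → (∃ ρ, R0 y ρ ∧ r ρ) → ¬ P y)
    (hj : ∀ u, E w u → (∃ y, R0 u y ∧ l y) → ∃ y', R0 u y' ∧ Lc y' ∧
      ∃ γ, R0 y' γ ∧ ¬ Lc γ ∧ ∃ y2, R0 γ y2 ∧ l y2)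
    (hk : ∀ u, E w u → (∃ y, R0 u y ∧ l y) → p u ∨ ∃ z, R0 u z ∧ p z ∧ ∃ y, R0 z y ∧ l y) :
    False := by
  have PE : ∀ x y, E x y → P x → P y := by
    intro x y h hx
    obtain ⟨z, h1, h2⟩ := (hP x).1 hx
    exact (hP y).2 ⟨z, tr _ _ _ (sym _ _ h) h1, h2⟩
  have LE : ∀ x y, E x y → Lc x → Lc y := by
    intro x y h hx
    obtain ⟨z, h1, h2⟩ := (hL x).1 hx
    exact (hL y).2 ⟨z, tr _ _ _ (sym _ _ h) h1, h2⟩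
  have DE : ∀ x y, E x y → D x → D y := by
    intro x y h hx
    rcases (hD x).1 hx with h1 | ⟨z, h1, h2⟩
    · exact (hD y).2 (Or.inl (tr _ _ _ h1 h))
    · exact (hD y).2 (Or.inr ⟨z, h1, tr _ _ _ h2 h⟩)
  have Dw : D w := (hD w).2 (Or.inl (rfl' w))
  have DR : ∀ x y, R0 x y → D x → D y := by
    intro x y h hx
    rcases (hD x).1 hx with h1 | ⟨z, h1, h2⟩
    · obtain ⟨d, h3, h4⟩ := comm2 _ _ _ h1 h
      exact (hD y).2 (Or.inr ⟨d, h3, h4⟩)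
    · obtain ⟨d, h3, h4⟩ := comm2 _ _ _ h2 h
      exact (hD y).2 (Or.inr ⟨d, trans _ _ _ h1 h3, h4⟩)
  obtain ⟨zE, hwz, hz1, hz2, hz3, hz4⟩ := hc
  -- finite cover
  let Good : W → Prop := fun x => ∃ F : Set W, F.Finite ∧ ∀ y, (y = x ∨ R0 x y) → P y → ∃ f ∈ F, E y f
  have good : Good w := by
    by_contra hw
    let S : Set W := {x | (x = w ∨ R0 w x) ∧ P x ∧ ¬ Good x}
    have hwS : w ∈ S := ⟨Or.inl rfl, ha, hw⟩
    obtain ⟨s, hs, hzs⟩ := alpha S (by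
      intro x hx
      obtain ⟨hwx, hPx, hGx⟩ := hx
      have Dx : D x := by
        rcases hwx with rfl | h
        · exact Dw
        · exact DR _ _ h Dw
      by_cases hn : ∃ y, R0 x y ∧ P y
      · obtain ⟨y0, hy0, hPy0⟩ := hn
        obtain ⟨z, hxz, hpz⟩ := (hP x).1 hPx
        have Dz : D z := DE _ _ hxz Dx
        obtain ⟨y1, hy1, hy1'⟩ := comm2 _ _ _ (sym _ _ hxz) hy0
        obtain ⟨g, hzg, hPg, ρ, hgρ, hrρ, hPρ⟩ := hf z Dz hpz ⟨y1, hy1, PE _ _ (sym _ _ hy1') hPy0⟩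
        obtain ⟨g', hxg', hg'⟩ := comm2 _ _ _ hxz hzg
        obtain ⟨x', hgx', hx'⟩ := comm2 _ _ _ hg' hgρ
        refine ⟨g', fun h => hPg (PE _ _ hg' h.2.1), hxg', x', ?_, hgx'⟩
        have hxx' := trans _ _ _ hxg' hgx'
        refine ⟨Or.inr ?_, PE _ _ (sym _ _ hx') hPρ, ?_⟩
        · rcases hwx with rfl | h
          · exact hxx'
          · exact trans _ _ _ h hxx'
        · rintro ⟨F, hF, hcov⟩
          apply hGx
          refine ⟨insert x (insert x' F), (hF.insert _).insert _, ?_⟩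
          rintro y (rfl | hxy) hPy
          · exact ⟨y, by simp, rfl' y⟩
          · obtain ⟨y2, hzy2, hy2⟩ := comm2 _ _ _ (sym _ _ hxz) hxy
            have hPy2 := PE _ _ (sym _ _ hy2) hPy
            rcases wc _ _ _ hzy2 (trans _ _ _ hzg hgρ) with h | h | h
            · subst h
              exact ⟨x', by simp, tr _ _ _ (sym _ _ hy2) (sym _ _ hx')⟩
            · exact absurd hPy2 (hh z Dz hpz y2 hzy2 ⟨ρ, h, hrρ⟩)
            · obtain ⟨y', h1, h2⟩ := comm2 _ _ _ hx' h
              obtain ⟨f, hf1, hf2⟩ := hcov y' (Or.inr h1) (PE _ _ (sym _ _ h2) hPy2)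
              exact ⟨f, by simp [hf1], tr _ _ _ (sym _ _ hy2) (tr _ _ _ (sym _ _ h2) hf2)⟩
      · exfalso
        apply hGx
        refine ⟨{x}, Set.finite_singleton _, ?_⟩
        rintro y (rfl | hxy) hPy
        · exact ⟨y, rfl, rfl' y⟩
        · exact absurd ⟨y, hxy, hPy⟩ hn) w hwS zE hwz
    exact hz3 _ hzs hs.2.1
  obtain ⟨F, hF, hcov⟩ := good
  -- l-points above the same point are equal
  have luniq : ∀ u y y', D u → R0 u y → R0 u y' → l y → l y' → y = y' := by
    intro u y y' Du h h' hl hl'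
    rcases wc _ _ _ h h' with e | e | e
    · exact e
    · exact absurd hl' (he _ _ (DR _ _ h Du) hl e)
    · exact absurd hl (he _ _ (DR _ _ h' Du) hl' e)
  let Ls : Set W := {y | l y ∧ ∃ y', R0 w y' ∧ E y' y}
  have LsF : Ls.Finite := by
    have key : ∀ y ∈ Ls, ∃ f ∈ F, ∃ z, D z ∧ p z ∧ E z f ∧ R0 z y := by
      rintro y ⟨hl, y', h1, h2⟩
      obtain ⟨u, hu, huy⟩ := comm1 _ _ _ h1 h2
      have Du : D u := DE _ _ hu Dw
      rcases hk u hu ⟨y, huy, hl⟩ with hp | ⟨z, huz, hpz, y2, hzy2, hl2⟩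
      · obtain ⟨f, hf1, hf2⟩ := hcov w (Or.inl rfl) ha
        exact ⟨f, hf1, u, Du, hp, tr _ _ _ (sym _ _ hu) hf2, huy⟩
      · have := luniq u y y2 Du huy (trans _ _ _ huz hzy2) hl hl2
        subst this
        obtain ⟨z', h3, h4⟩ := comm2 _ _ _ hu huz
        obtain ⟨f, hf1, hf2⟩ := hcov z' (Or.inr h3) ((hP _).2 ⟨z, h4, hpz⟩)
        exact ⟨f, hf1, z, DR _ _ huz Du, hpz, tr _ _ _ (sym _ _ h4) hf2, hzy2⟩
    choose! φ hφF hφ using key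
    refine Set.Finite.of_finite_image (f := φ) (hF.subset ?_) ?_
    · rintro _ ⟨y, hy, rfl⟩
      exact hφF y hy
    · intro y hy y' hy' e
      obtain ⟨z, Dz, pz, ez, rz⟩ := hφ y hy
      obtain ⟨z', Dz', pz', ez', rz'⟩ := hφ y' hy'
      have : z = z' := hd _ _ Dz pz pz' (tr _ _ _ ez (sym _ _ (by rw [← e] at ez'; exact ez')))
      subst this
      exact luniq z y y' Dz rz rz' hy.1 hy'.1
  let DD : W → W → Prop := fun y1 y => ∃ a g a', E a y1 ∧ R0 a g ∧ ¬ Lc g ∧ R0 g a' ∧ E a' y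
  have DDtr : ∀ x y z, DD x y → DD y z → DD x z := by
    rintro x y z ⟨a, g, a', h1, h2, h3, h4, h5⟩ ⟨b, k, b', h6, h7, h8, h9, h10⟩
    obtain ⟨c, hc1, hc2⟩ := comm2 a' b k (tr _ _ _ h5 (sym _ _ h6)) h7
    obtain ⟨c', hc3, hc4⟩ := comm2 c k b' hc2 h9
    exact ⟨a, g, c', h1, h2, h3, trans _ _ _ h4 (trans _ _ _ hc1 hc3), tr _ _ _ hc4 h10⟩
  have DDirr : ∀ y ∈ Ls, ¬ DD y y := by
    rintro y ⟨hl, y', h1, h2⟩ ⟨a, g, a', ha1, hg1, hg2, ha2, ha3⟩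
    have hLy : Lc y := (hL y).2 ⟨y, rfl' y, hl⟩
    have hLy' : Lc y' := LE _ _ (sym _ _ h2) hLy
    have hyz : R0 y' zE := by
      rcases wc _ _ _ h1 hwz with e | e | e
      · subst e; exact absurd hLy' hz2
      · exact e
      · exact absurd hLy' (hz4 _ e)
    obtain ⟨s, hs, hzs⟩ := alpha {a | E a y} (by
      intro b hb
      obtain ⟨c, hc1, hc2⟩ := comm2 b a g (tr _ _ _ hb (sym _ _ ha1)) hg1
      obtain ⟨c', hc3, hc4⟩ := comm2 c g a' hc2 ha2
      refine ⟨c, ?_, hc1, c', tr _ _ _ hc4 ha3, hc3⟩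
      intro hcy
      exact hg2 (LE _ _ hc2 (LE _ _ (sym _ _ hcy) hLy))) y' h2 zE hyz
    exact hz4 _ hzs (LE _ _ (sym _ _ hs) hLy)
  have DDpre : ∀ y ∈ Ls, ∃ y1 ∈ Ls, DD y1 y := by
    rintro y ⟨hl, y', h1, h2⟩
    obtain ⟨u, hu, huy⟩ := comm1 _ _ _ h1 h2
    have Du : D u := DE _ _ hu Dw
    obtain ⟨v, huv, hLv, γ, hvγ, hLγ, y2, hγ2, hl2⟩ := hj u hu ⟨y, huy, hl⟩
    have := luniq u y y2 Du huy (trans _ _ _ huv (trans _ _ _ hvγ hγ2)) hl hl2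
    subst this
    obtain ⟨y1, hvy1, hl1⟩ := (hL v).1 hLv
    obtain ⟨v', h3, h4⟩ := comm2 _ _ _ hu huv
    exact ⟨y1, ⟨hl1, v', h3, tr _ _ _ h4 hvy1⟩, v, γ, y, hvy1, hvγ, hLγ, hγ2, rfl' y⟩
  obtain ⟨y0, hwy0, hLy0⟩ := hb
  obtain ⟨y, hyy, hly⟩ := (hL y0).1 hLy0
  have hyL : y ∈ Ls := ⟨hly, y0, hwy0, hyy⟩
  haveI : Finite Ls := LsF
  haveI : IsTrans Ls (fun a b => DD a.1 b.1) := ⟨fun a b c => DDtr _ _ _⟩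
  haveI : Std.Irrefl (fun a b : Ls => DD a.1 b.1) := ⟨fun a => DDirr _ a.2⟩
  have wf := Finite.wellFounded_of_trans_of_irrefl (fun a b : Ls => DD a.1 b.1)
  obtain ⟨m, -, hm⟩ := wf.has_min Set.univ ⟨⟨y, hyL⟩, trivial⟩
  obtain ⟨y1, h1, h2⟩ := DDpre m.1 m.2
  exact hm ⟨y1, h1⟩ trivial h2


open BForm

def orF (φ ψ : BForm) : BForm := neg (and (neg φ) (neg ψ))

section sat
variable {W : Type} {R0 R1 : W → W → Prop} {val : ℕ → W → Prop} {w : W} {φ ψ : BForm}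

theorem sat_var {n : ℕ} : BSat R0 R1 val w (var n) ↔ val n w := Iff.rfl
theorem sat_neg : BSat R0 R1 val w (neg φ) ↔ ¬ BSat R0 R1 val w φ := Iff.rfl
theorem sat_and : BSat R0 R1 val w (and φ ψ) ↔ BSat R0 R1 val w φ ∧ BSat R0 R1 val w ψ := Iff.rfl
theorem sat_dia0 : BSat R0 R1 val w (dia0 φ) ↔ ∃ v, R0 w v ∧ BSat R0 R1 val v φ := Iff.rfl
theorem sat_dia1 : BSat R0 R1 val w (dia1 φ) ↔ ∃ v, R1 w v ∧ BSat R0 R1 val v φ := Iff.rfl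
theorem sat_imp : BSat R0 R1 val w (imp φ ψ) ↔ (BSat R0 R1 val w φ → BSat R0 R1 val w ψ) := by
  simp only [imp, sat_neg, sat_and]; tauto
theorem sat_or : BSat R0 R1 val w (orF φ ψ) ↔ (BSat R0 R1 val w φ ∨ BSat R0 R1 val w ψ) := by
  simp only [orF, sat_neg, sat_and]; tauto
theorem sat_box0 : BSat R0 R1 val w (box0 φ) ↔ ∀ v, R0 w v → BSat R0 R1 val v φ := by
  simp only [box0, sat_neg, sat_dia0]; push Not; rfl
theorem sat_box1 : BSat R0 R1 val w (box1 φ) ↔ ∀ v, R1 w v → BSat R0 R1 val v φ := by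
  simp only [box1, sat_neg, sat_dia1]; push Not; rfl
end sat

/-! ### Frame correspondence -/

def axTr : BForm := imp (dia0 (dia0 (var 0))) (dia0 (var 0))
def axWc : BForm := imp (and (dia0 (var 0)) (dia0 (var 1)))
  (orF (dia0 (and (var 0) (var 1))) (orF (dia0 (and (var 0) (dia0 (var 1))))
    (dia0 (and (var 1) (dia0 (var 0))))))
def axAl : BForm := imp (and (boxP0 (imp (var 0) (dia0 (and (neg (var 0)) (dia0 (var 0)))))) (var 0))
  (box0 (dia0 (var 0)))

theorem axTr_mem : axTr ∈ DisK43 := by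
  refine ⟨by simp [axTr, imp, OnlyDia0], ?_⟩
  intro T R _ hw _ val w
  simp only [axTr, sat_imp, sat_dia0, sat_var]
  rintro ⟨v, h1, u, h2, h3⟩
  exact ⟨u, hw.1 _ _ _ h1 h2, h3⟩

theorem axWc_mem : axWc ∈ DisK43 := by
  refine ⟨by simp [axWc, imp, orF, OnlyDia0], ?_⟩
  intro T R _ hw _ val w
  simp only [axWc, sat_imp, sat_dia0, sat_var, sat_and, sat_or]
  rintro ⟨⟨v, h1, h2⟩, u, h3, h4⟩
  rcases hw.2 _ _ _ h1 h3 with e | e | e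
  · subst e; exact Or.inl ⟨v, h1, h2, h4⟩
  · exact Or.inr (Or.inl ⟨v, h1, h2, u, e, h4⟩)
  · exact Or.inr (Or.inr ⟨u, h3, h4, v, e, h2⟩)

theorem axAl_mem : axAl ∈ DisK43 := by
  refine ⟨by simp [axAl, imp, boxP0, box0, OnlyDia0], ?_⟩
  intro T R _ hw hd val w
  simp only [axAl, boxP0, sat_imp, sat_dia0, sat_var, sat_and, sat_box0, sat_neg]
  rintro ⟨⟨h0, hs⟩, hpw⟩ z hwz
  by_contra hz
  push Not at hz
  have hall : ∀ x, (x = w ∨ R w x) → val 0 x → ∃ v, R x v ∧ ¬ val 0 v ∧ ∃ u, R v u ∧ val 0 u := by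
    rintro x (rfl | h)
    · exact h0
    · exact hs x h
  let Q : T → Prop := fun x => (x = w ∨ R w x) ∧ (val 0 x ∨ ∃ y, R x y ∧ val 0 y)
  have ext : ∀ x y, (x = w ∨ R w x) → R x y → R w y := by
    rintro x y (rfl | h) h'
    · exact h'
    · exact hw.1 _ _ _ h h'
  have step : ∀ x : {x // Q x}, ∃ y : {x // Q x}, R x.1 y.1 ∧ x.1 ≠ y.1 := by
    rintro ⟨x, hx1, hx2⟩
    by_cases hp : val 0 x
    · obtain ⟨g, h1, h2, u, h3, h4⟩ := hall x hx1 hp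
      refine ⟨⟨g, Or.inr (ext _ _ hx1 h1), Or.inr ⟨u, h3, h4⟩⟩, h1, ?_⟩
      rintro rfl; exact h2 hp
    · rcases hx2 with h | ⟨y, h1, h2⟩
      · exact absurd h hp
      · refine ⟨⟨y, Or.inr (ext _ _ hx1 h1), Or.inl h2⟩, h1, ?_⟩
        intro e; exact hp ((show x = y from e) ▸ h2)
  choose f hf1 hf2 using step
  let s : ℕ → {x // Q x} := fun n => f^[n] ⟨w, Or.inl rfl, Or.inl hpw⟩
  have hs1 : ∀ n, s (n+1) = f (s n) := fun n => Function.iterate_succ_apply' f n _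
  have nz : ∀ x, Q x → ¬ R z x := by
    rintro x ⟨h1, h2 | ⟨y, h2, h3⟩⟩ h
    · exact hz _ h h2
    · exact hz _ (hw.1 _ _ _ h h2) h3
  have future : ∀ x, Q x → ∃ y, R x y ∧ val 0 y := by
    rintro x ⟨h1, h2 | h2⟩
    · obtain ⟨g, h3, _, u, h5, h6⟩ := hall x h1 h2
      exact ⟨u, hw.1 _ _ _ h3 h5, h6⟩
    · exact h2
  apply hd
  refine ⟨fun n => (s n).1, z, ?_, ?_, ?_, fun i => nz _ (s i).2⟩
  · intro i; simp only [hs1]; exact hf1 _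
  · intro i; simp only [hs1]; exact hf2 _
  · intro i
    rcases (s i).2.1 with e | e
    · show R (s i).1 z
      rw [e]; exact hwz
    · rcases hw.2 _ _ _ e hwz with h | h | h
      · obtain ⟨y, h1, h2⟩ := future _ (s i).2
        rw [h] at h1
        exact absurd h2 (hz _ h1)
      · exact h
      · exact absurd h (nz _ (s i).2)

theorem disK43_sub_GL3 : DisK43 ⊆ GL3 := by
  rintro φ ⟨h1, h2⟩
  refine ⟨h1, fun T R ne hl hn => h2 T R ne ⟨hl.2.1, ?_⟩ ?_⟩
  · intro x y z _ _
    rcases hl.2.2 y z with h | h | h <;> tauto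
  · rintro ⟨x, xo, h3, h4, _⟩
    exact hn ⟨x, h3, h4⟩

theorem disK43_sub_omega : DisK43 ⊆ LogOmega := by
  rintro φ ⟨h1, h2⟩
  refine ⟨h1, h2 ℕ _ ⟨0⟩ ⟨fun x y z h h' => lt_trans h h', fun x y z _ _ => by omega⟩ ?_⟩
  rintro ⟨x, xo, h3, h4, h5, _⟩
  have : ∀ i, i ≤ x i := by
    intro i
    induction i with
    | zero => omega
    | succ n ih => have := h3 n; omega
  have := this xo
  have := h5 xo
  omega

/-! ### The formula -/

def fP : BForm := orF (var 0) (dia1 (var 0))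
def fL : BForm := orF (var 2) (dia1 (var 2))
def fU (χ : BForm) : BForm := and (boxP1 χ) (box0 (boxP1 χ))

def phiA : BForm := fP
def phiB : BForm := dia0 fL
def phiC : BForm := dia0 (and (neg fP) (and (neg fL) (and (box0 (neg fP)) (box0 (neg fL)))))
def phiD : BForm := fU (imp (var 0) (box1 (neg (var 0))))
def phiE : BForm := fU (imp (var 2) (box0 (neg (var 2))))
def phiF : BForm := fU (imp (and (var 0) (dia0 fP)) (dia0 (and (neg fP) (dia0 (and (var 1) fP)))))
def phiH : BForm := fU (imp (var 0) (box0 (imp (dia0 (var 1)) (neg fP))))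
def phiJ : BForm := boxP1 (imp (dia0 (var 2)) (dia0 (and fL (dia0 (and (neg fL) (dia0 (var 2)))))))
def phiK : BForm := boxP1 (imp (dia0 (var 2)) (orF (var 0) (dia0 (and (var 0) (dia0 (var 2))))))
def phi : BForm := and phiA (and phiB (and phiC (and phiD (and phiE (and phiF (and phiH
  (and phiJ phiK)))))))

section sat2
variable {W : Type} {R0 R1 : W → W → Prop} {val : ℕ → W → Prop} {w : W} {φ : BForm}
theorem sat_boxP1 : BSat R0 R1 val w (boxP1 φ) ↔ ∀ v, (w = v ∨ R1 w v) → BSat R0 R1 val v φ := by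
  simp only [boxP1, sat_and, sat_box1]
  constructor
  · rintro ⟨h1, h2⟩ v (rfl | h)
    exacts [h1, h2 v h]
  · intro h; exact ⟨h _ (Or.inl rfl), fun v hv => h v (Or.inr hv)⟩
theorem sat_fU : BSat R0 R1 val w (fU φ) ↔ ∀ x, ((w = x ∨ R1 w x) ∨ ∃ y, R0 w y ∧ (y = x ∨ R1 y x)) →
    BSat R0 R1 val x φ := by
  simp only [fU, sat_and, sat_box0, sat_boxP1]
  constructor
  · rintro ⟨h1, h2⟩ x (h | ⟨y, h3, h4⟩)
    exacts [h1 x h, h2 y h3 x h4]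
  · intro h; exact ⟨fun v hv => h _ (Or.inl hv), fun y hy v hv => h v (Or.inr ⟨y, hy, hv⟩)⟩
theorem sat_diaP {n : ℕ} : BSat R0 R1 val w (orF (var n) (dia1 (var n))) ↔
    ∃ y, (w = y ∨ R1 w y) ∧ val n y := by
  simp only [sat_or, sat_var, sat_dia1]
  constructor
  · rintro (h | ⟨y, h1, h2⟩)
    exacts [⟨w, Or.inl rfl, h⟩, ⟨y, Or.inr h1, h2⟩]
  · rintro ⟨y, rfl | h, h2⟩
    exacts [Or.inl h2, Or.inr ⟨y, h, h2⟩]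
end sat2

def axSym : BForm := imp (var 0) (box1 (dia1 (var 0)))
def axPtr : BForm := imp (dia1 (dia1 (var 0))) (orF (var 0) (dia1 (var 0)))

theorem axSym_mem : axSym ∈ DiffLogic := by
  refine ⟨by simp [axSym, imp, box1, OnlyDia1], ?_⟩
  intro D _ val w
  simp only [axSym, sat_imp, sat_box1, sat_dia1, sat_var]
  intro h v hv
  exact ⟨w, hv.symm, h⟩

theorem axPtr_mem : axPtr ∈ DiffLogic := by
  refine ⟨by simp [axPtr, imp, orF, OnlyDia1], ?_⟩
  intro D _ val w
  simp only [axPtr, sat_imp, sat_or, sat_dia1, sat_var]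
  rintro ⟨v, hv, u, hu, h⟩
  by_cases e : w = u
  · subst e; exact Or.inl h
  · exact Or.inr ⟨u, e, h⟩

theorem kripke_unsat (F : Frame2) (h : ∀ ψ ∈ Commutator DisK43 DiffLogic, F.Valid ψ) :
    F.Valid (neg phi) := by
  have hl : ∀ ψ ∈ DisK43, F.Valid ψ := fun ψ hψ => h ψ (fun L hL => hL.2.1 hψ)
  have hd : ∀ ψ ∈ DiffLogic, F.Valid ψ := fun ψ hψ => h ψ (fun L hL => hL.2.2.1 hψ)
  have h1 : F.Valid commAx1 := h _ (fun L hL => hL.2.2.2.1)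
  have h2 : F.Valid commAx2 := h _ (fun L hL => hL.2.2.2.2.1)
  have trans : ∀ x y z, F.R0 x y → F.R0 y z → F.R0 x z := by
    intro x y z hxy hyz
    have := hl _ axTr_mem (fun _ u => u = z) x
    simp only [axTr, sat_imp, sat_dia0, sat_var] at this
    obtain ⟨v, hv, rfl⟩ := this ⟨y, hxy, z, hyz, rfl⟩
    exact hv
  have wc : ∀ x y z, F.R0 x y → F.R0 x z → y = z ∨ F.R0 y z ∨ F.R0 z y := by
    intro x y z hxy hxz
    have := hl _ axWc_mem (fun n u => if n = 0 then u = y else u = z) x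
    simp only [axWc, sat_imp, sat_dia0, sat_var, sat_and, sat_or] at this
    rcases this ⟨⟨y, hxy, rfl⟩, z, hxz, rfl⟩ with ⟨v, _, e1, e2⟩ | ⟨v, _, e1, u, hu, e2⟩ | ⟨v, _, e1, u, hu, e2⟩
    · simp at e1 e2; subst e1; exact Or.inl e2
    · simp at e1 e2; subst e1 e2; exact Or.inr (Or.inl hu)
    · simp at e1 e2; subst e1 e2; exact Or.inr (Or.inr hu)
  have sym : ∀ x y, F.R1 x y → F.R1 y x := by
    intro x y hxy
    have := hd _ axSym_mem (fun _ u => u = x) x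
    simp only [axSym, sat_imp, sat_dia1, sat_var, sat_box1] at this
    obtain ⟨v, hv, rfl⟩ := this trivial y hxy
    exact hv
  have ptr : ∀ x y z, F.R1 x y → F.R1 y z → x = z ∨ F.R1 x z := by
    intro x y z hxy hyz
    have := hd _ axPtr_mem (fun _ u => u = z) x
    simp only [axPtr, sat_imp, sat_dia1, sat_var, sat_or] at this
    rcases this ⟨y, hxy, z, hyz, rfl⟩ with h | ⟨v, hv, rfl⟩
    · exact Or.inl h
    · exact Or.inr hv
  intro val w hphi
  simp only [phi, sat_and] at hphi
  obtain ⟨pa, pb, pc, pd, pe, pf, ph, pj, pk⟩ := hphi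
  let E : F.W → F.W → Prop := fun x y => x = y ∨ F.R1 x y
  have dia : ∀ n x, BSat F.R0 F.R1 val x (orF (var n) (dia1 (var n))) ↔ ∃ y, E x y ∧ val n y :=
    fun n x => sat_diaP
  refine kripke_core F.R0 E (fun x => Or.inl rfl) ?_ ?_ trans wc ?_ ?_ ?_ (val 0) (val 1) (val 2)
    (fun x => BSat F.R0 F.R1 val x fP) (fun x => BSat F.R0 F.R1 val x fL)
    (fun x => dia 0 x) (fun x => dia 2 x) w
    (fun x => E w x ∨ ∃ y, F.R0 w y ∧ E y x) (fun x => Iff.rfl) pa pb ?_ ?_ ?_ ?_ ?_ ?_ ?_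
  · rintro x y (rfl | h)
    exacts [Or.inl rfl, Or.inr (sym _ _ h)]
  · rintro x y z (rfl | h) (rfl | h')
    exacts [Or.inl rfl, Or.inr h', Or.inr h, ptr _ _ _ h h']
  · intro S hS b hb z hbz
    have := hl _ axAl_mem (fun _ u => u ∈ S) b
    simp only [axAl, boxP0, sat_imp, sat_dia0, sat_var, sat_and, sat_box0, sat_neg] at this
    have hS' : ∀ v, v ∈ S → ∃ v_1, F.R0 v v_1 ∧ v_1 ∉ S ∧ ∃ v, F.R0 v_1 v ∧ v ∈ S := by
      intro v hv
      obtain ⟨g, g1, g2, a', g3, g4⟩ := hS v hv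
      exact ⟨g, g2, g1, a', g4, g3⟩
    obtain ⟨v, hv, hvS⟩ := this ⟨⟨hS' b, fun v _ => hS' v⟩, hb⟩ z hbz
    exact ⟨v, hvS, hv⟩
  · rintro w x y hwx (rfl | hxy)
    · exact ⟨w, Or.inl rfl, hwx⟩
    · have := h1 (fun _ u => u ≠ y) w
      simp only [commAx1, sat_imp, sat_box0, sat_box1, sat_var] at this
      by_contra hcon
      push Not at hcon
      refine this ?_ x hwx y hxy rfl
      rintro u hu v hv rfl
      exact hcon u (Or.inr hu) hv
  · rintro a b c (rfl | hab) hbc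
    · exact ⟨c, hbc, Or.inl rfl⟩
    · have := h2 (fun _ u => u ≠ c) a
      simp only [commAx2, sat_imp, sat_box0, sat_box1, sat_var] at this
      by_contra hcon
      push Not at hcon
      refine this ?_ b hab c hbc rfl
      rintro u hu v hv rfl
      exact hcon u hu (Or.inr hv)
  · simpa only [phiC, sat_dia0, sat_and, sat_neg, sat_box0] using pc
  · intro x y Dx hx hy hxy
    have := (sat_fU.1 pd) x Dx
    simp only [sat_imp, sat_box1, sat_neg, sat_var] at this
    rcases hxy with e | e
    · exact e
    · exact absurd hy (this hx y e)
  · intro x y Dx hx hxy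
    have := (sat_fU.1 pe) x Dx
    simp only [sat_imp, sat_box0, sat_neg, sat_var] at this
    exact this hx y hxy
  · intro x Dx hx hxy
    have := (sat_fU.1 pf) x Dx
    simp only [sat_imp, sat_dia0, sat_neg, sat_var, sat_and] at this
    exact this ⟨hx, hxy⟩
  · intro x Dx hx y hxy hy
    have := (sat_fU.1 ph) x Dx
    simp only [sat_imp, sat_dia0, sat_box0, sat_neg, sat_var, sat_and] at this
    exact this hx y hxy hy
  · intro u hu
    have := (sat_boxP1.1 pj) u hu
    simpa only [sat_imp, sat_dia0, sat_box0, sat_neg, sat_var, sat_and] using this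
  · intro u hu
    have := (sat_boxP1.1 pk) u hu
    simpa only [sat_imp, sat_dia0, sat_or, sat_neg, sat_var, sat_and] using this



structure ClosedA {T V : Type} (R : T → T → Prop) (A : (T × V → Prop) → Prop) : Prop where
  neg : ∀ X, A X → A (fun x => ¬ X x)
  and : ∀ X Y, A X → A Y → A (fun x => X x ∧ Y x)
  dia0 : ∀ X, A X → A (fun x => ∃ y, prodR0 R x y ∧ X y)
  dia1 : ∀ X, A X → A (fun x => ∃ y, prodR1 (fun a b : V => a ≠ b) x y ∧ X y)

def genLogic {T V : Type} (R : T → T → Prop) (A : (T × V → Prop) → Prop) : Set BForm :=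
  {ψ | ∀ val : ℕ → T × V → Prop, (∀ i, A (val i)) →
    ∀ x, BSat (prodR0 R) (prodR1 (fun a b : V => a ≠ b)) val x ψ}

section gen
variable {T V : Type} {R : T → T → Prop} {A : (T × V → Prop) → Prop}

theorem A_sat (hA : ClosedA R A) (val : ℕ → T × V → Prop) (hv : ∀ i, A (val i)) (ψ : BForm) :
    A (fun x => BSat (prodR0 R) (prodR1 (fun a b : V => a ≠ b)) val x ψ) := by
  induction ψ with
  | var n => exact hv n
  | neg φ ih => exact hA.neg _ ih
  | and φ ψ ih1 ih2 => exact hA.and _ _ ih1 ih2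
  | dia0 φ ih => exact hA.dia0 _ ih
  | dia1 φ ih => exact hA.dia1 _ ih

theorem sat_subst {W : Type} (R0 R1 : W → W → Prop) (val : ℕ → W → Prop) (s : ℕ → BForm)
    (ψ : BForm) : ∀ w, BSat R0 R1 val w (ψ.subst s) ↔
      BSat R0 R1 (fun n w => BSat R0 R1 val w (s n)) w ψ := by
  induction ψ with
  | var n => intro w; rfl
  | neg φ ih => intro w; simp only [BForm.subst, sat_neg, ih]
  | and φ ψ ih1 ih2 => intro w; simp only [BForm.subst, sat_and, ih1, ih2]
  | dia0 φ ih => intro w; simp only [BForm.subst, sat_dia0, ih]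
  | dia1 φ ih => intro w; simp only [BForm.subst, sat_dia1, ih]

theorem gen_isLogic (hA : ClosedA R A) : IsLogic (genLogic R A) where
  taut := by
    intro φ h val _ x
    exact h (fun ψ => BSat _ _ val x ψ) (fun ψ => Iff.rfl) (fun ψ χ => Iff.rfl)
  K0 := by
    intro val _ x
    simp only [sat_imp, sat_box0, sat_var]
    intro h1 h2 v hv
    exact h1 v hv (h2 v hv)
  K1 := by
    intro val _ x
    simp only [sat_imp, sat_box1, sat_var]
    intro h1 h2 v hv
    exact h1 v hv (h2 v hv)
  mp := by
    intro φ ψ h1 h2 val hv x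
    exact sat_imp.1 (h1 val hv x) (h2 val hv x)
  subst := by
    intro φ s h val hv x
    rw [sat_subst]
    exact h _ (fun i => A_sat hA val hv (s i)) x
  nec0 := by
    intro φ h val hv x
    rw [sat_box0]
    exact fun v _ => h val hv v
  nec1 := by
    intro φ h val hv x
    rw [sat_box1]
    exact fun v _ => h val hv v

theorem gen_comm1 : commAx1 ∈ genLogic R A := by
  rintro val _ ⟨t, v⟩
  simp only [commAx1, sat_imp, sat_box0, sat_box1, sat_var]
  rintro h ⟨t1, v1⟩ ⟨h1, h2⟩ ⟨t2, v2⟩ ⟨h3, h4⟩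
  simp only at h1 h2 h3 h4
  subst h2 h3
  exact h (t, v2) ⟨rfl, h4⟩ (t1, v2) ⟨h1, rfl⟩

theorem gen_comm2 : commAx2 ∈ genLogic R A := by
  rintro val _ ⟨t, v⟩
  simp only [commAx2, sat_imp, sat_box0, sat_box1, sat_var]
  rintro h ⟨t1, v1⟩ ⟨h1, h2⟩ ⟨t2, v2⟩ ⟨h3, h4⟩
  simp only at h1 h2 h3 h4
  subst h1 h4
  exact h (t2, v) ⟨h3, rfl⟩ (t2, v1) ⟨rfl, h2⟩

theorem gen_comm3 : commAx3 ∈ genLogic R A := by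
  rintro val _ ⟨t, v⟩
  simp only [commAx3, sat_imp, sat_dia0, sat_box1, sat_var]
  rintro ⟨⟨t1, v1⟩, ⟨h1, h2⟩, h⟩ ⟨t2, v2⟩ ⟨h3, h4⟩
  simp only at h1 h2 h3 h4
  subst h2 h3
  exact ⟨(t1, v2), ⟨h1, rfl⟩, h (t1, v2) ⟨rfl, h4⟩⟩

theorem gen_diff : DiffLogic ⊆ genLogic R A := by
  rintro φ ⟨h1, h2⟩ val _ ⟨t, v⟩
  have key : ∀ ψ : BForm, ψ.OnlyDia1 → ∀ v : V,
      BSat (fun _ _ => False) (fun a b : V => a ≠ b) (fun n v => val n (t, v)) v ψ ↔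
      BSat (prodR0 R) (prodR1 (fun a b : V => a ≠ b)) val (t, v) ψ := by
    intro ψ
    induction ψ with
    | var n => intro _ v; rfl
    | neg φ ih => intro h v; simp only [sat_neg, ih h]
    | and φ ψ ih1 ih2 => intro h v; simp only [sat_and, ih1 h.1, ih2 h.2]
    | dia0 φ ih => intro h; exact h.elim
    | dia1 φ ih =>
      intro h v
      simp only [sat_dia1]
      constructor
      · rintro ⟨u, hu, hs⟩
        exact ⟨(t, u), ⟨rfl, hu⟩, (ih h u).1 hs⟩
      · rintro ⟨⟨t', u⟩, ⟨e, hu⟩, hs⟩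
        simp only at e hu
        subst e
        exact ⟨u, hu, (ih h u).2 hs⟩
  exact (key φ h1 v).1 (h2 V ⟨v⟩ _ v)

/-- rows of sets in `A` have maxima -/
def MaxProp (lt : T → T → Prop) (A : (T × V → Prop) → Prop) : Prop :=
  ∀ X, A X → ∀ v t, X (t, v) → ∃ M, X (M, v) ∧ ∀ s, X (s, v) → s = M ∨ lt s M

theorem pm (hA : ClosedA R A) {lt : T → T → Prop} (hm : MaxProp lt A)
    (hR : ∀ a t M, R a t → lt t M → R a M)
    (val : ℕ → T × V → Prop) (hv : ∀ i, A (val i)) (v : V) (ψ : BForm) :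
    ψ.OnlyDia0 → ∃ S : Set T, S.Finite ∧ ∀ (X : Type) (RX : X → X → Prop) (f : X → T),
      (∀ i j, RX i j → R (f i) (f j)) → (∀ i, ∀ s ∈ S, R (f i) s → ∃ j, RX i j ∧ f j = s) →
      ∀ i, BSat RX (fun _ _ => False) (fun n i => val n (f i, v)) i ψ ↔
        BSat (prodR0 R) (prodR1 (fun a b : V => a ≠ b)) val (f i, v) ψ := by
  induction ψ with
  | var n => intro _; exact ⟨∅, Set.finite_empty, fun X RX f _ _ i => Iff.rfl⟩
  | neg φ ih =>
    intro h
    obtain ⟨S, hS, hh⟩ := ih h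
    refine ⟨S, hS, fun X RX f h1 h2 i => ?_⟩
    simp only [sat_neg, hh X RX f h1 h2]
  | and φ ψ ih1 ih2 =>
    intro h
    obtain ⟨S, hS, hh⟩ := ih1 h.1
    obtain ⟨S', hS', hh'⟩ := ih2 h.2
    refine ⟨S ∪ S', hS.union hS', fun X RX f h1 h2 i => ?_⟩
    simp only [sat_and, hh X RX f h1 (fun i s hs => h2 i s (Or.inl hs)),
      hh' X RX f h1 (fun i s hs => h2 i s (Or.inr hs))]
  | dia1 φ ih => intro h; exact h.elim
  | dia0 φ ih =>
    intro h
    obtain ⟨S, hS, hh⟩ := ih h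
    have hAφ := A_sat hA val hv φ
    by_cases hne : ∃ t, BSat (prodR0 R) (prodR1 (fun a b : V => a ≠ b)) val (t, v) φ
    · obtain ⟨t, ht⟩ := hne
      obtain ⟨M, hM1, hM2⟩ := hm _ hAφ v t ht
      refine ⟨insert M S, hS.insert M, fun X RX f h1 h2 i => ?_⟩
      have hh2 := hh X RX f h1 (fun i s hs => h2 i s (Or.inr hs))
      simp only [sat_dia0, hh2]
      constructor
      · rintro ⟨j, hj, hs⟩
        exact ⟨(f j, v), ⟨h1 _ _ hj, rfl⟩, hs⟩
      · rintro ⟨⟨t', u⟩, ⟨hr, e⟩, hs⟩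
        simp only at hr e
        subst e
        have : R (f i) M := by
          rcases hM2 t' hs with e | e
          · exact e ▸ hr
          · exact hR _ _ _ hr e
        obtain ⟨j, hj, e⟩ := h2 i M (Or.inl rfl) this
        exact ⟨j, hj, e ▸ hM1⟩
    · refine ⟨S, hS, fun X RX f h1 h2 i => ?_⟩
      simp only [sat_dia0, hh X RX f h1 h2]
      constructor
      · rintro ⟨j, hj, hs⟩
        exact ⟨(f j, v), ⟨h1 _ _ hj, rfl⟩, hs⟩
      · rintro ⟨⟨t', u⟩, ⟨hr, e⟩, hs⟩
        simp only at hr e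
        subst e
        exact absurd ⟨t', hs⟩ hne

theorem gen_GL3 (hA : ClosedA R A) (hm : MaxProp R A) (hl : IsLin R) : GL3 ⊆ genLogic R A := by
  rintro φ ⟨h1, h2⟩ val hv ⟨t, v⟩
  obtain ⟨S, hS, hh⟩ := pm hA hm hl.2.1 val hv v φ h1
  let X : Set T := insert t S
  have hX : X.Finite := hS.insert t
  have hfin : Finite X := hX
  refine (hh X (fun a b => R a.1 b.1) (fun a => a.1) (fun _ _ h => h) ?_ ⟨t, Or.inl rfl⟩).1 ?_
  · intro i s hs hr
    exact ⟨⟨s, Or.inr hs⟩, hr, rfl⟩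
  · refine h2 X (fun a b => R a.1 b.1) ⟨⟨t, Or.inl rfl⟩⟩
      ⟨fun x => hl.1 _, fun x y z => hl.2.1 _ _ _, ?_⟩ ?_ _ _
    · intro x y
      rcases hl.2.2 x.1 y.1 with h | h | h
      · exact Or.inl h
      · exact Or.inr (Or.inl (Subtype.ext h))
      · exact Or.inr (Or.inr h)
    · rintro ⟨x, h3, -⟩
      have hlt : ∀ i k, R (x i).1 (x (i + k + 1)).1 := by
        intro i k
        induction k with
        | zero => exact h3 i
        | succ k ih => exact hl.2.1 _ _ _ ih (h3 _)
      obtain ⟨i, j, hij, e⟩ := Finite.exists_ne_map_eq_of_infinite x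
      rcases lt_or_gt_of_ne hij with h | h
      · obtain ⟨k, rfl⟩ := Nat.exists_eq_add_of_lt h
        have := hlt i k
        rw [← e] at this
        exact hl.1 _ this
      · obtain ⟨k, rfl⟩ := Nat.exists_eq_add_of_lt h
        have := hlt j k
        rw [e] at this
        exact hl.1 _ this

theorem gen_omega {lt : T → T → Prop} (e : T) (hlt : IsLin lt) (hmax : ∀ t, ¬ lt e t)
    (hRd : ∀ a b, R a b ↔ lt a b ∨ (a = e ∧ b = e))
    (hA : ClosedA R A) (hm : MaxProp lt A) : LogOmega ⊆ genLogic R A := by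
  rintro φ ⟨h1, h2⟩ val hv ⟨t, v⟩
  have hRtr : ∀ a b c, R a b → R b c → R a c := by
    intro a b c hab hbc
    rw [hRd] at hab hbc ⊢
    rcases hab with h | ⟨rfl, rfl⟩
    · rcases hbc with h' | ⟨rfl, rfl⟩
      · exact Or.inl (hlt.2.1 _ _ _ h h')
      · exact Or.inl h
    · exact hbc
  obtain ⟨S0, hS0, hh⟩ := pm hA hm (fun a b c h h' => hRtr a b c h ((hRd _ _).2 (Or.inl h'))) val hv v φ h1
  let S : Set T := insert e S0
  have hS : S.Finite := hS0.insert e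
  have hfin : Finite S := hS
  have toE : ∀ a, R a e := by
    intro a
    rw [hRd]
    rcases hlt.2.2 a e with h | h | h
    · exact Or.inl h
    · exact Or.inr ⟨h, rfl⟩
    · exact absurd h (hmax _)
  have tr1 : IsTrans S (fun a b => lt a.1 b.1) := ⟨fun a b c => hlt.2.1 _ _ _⟩
  have ir1 : Std.Irrefl (fun a b : S => lt a.1 b.1) := ⟨fun a => hlt.1 _⟩
  have wf := Finite.wellFounded_of_trans_of_irrefl (fun a b : S => lt a.1 b.1)
  have step : ∀ a, ∃ m ∈ S, R a m ∧ ∀ s ∈ S, R a s → s = m ∨ lt m s := by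
    intro a
    obtain ⟨m, hm1, hm2⟩ := wf.has_min {s : S | R a s.1} ⟨⟨e, Or.inl rfl⟩, toE a⟩
    refine ⟨m.1, m.2, hm1, ?_⟩
    intro s hs has
    rcases hlt.2.2 s m.1 with h | h | h
    · exact absurd h (hm2 ⟨s, hs⟩ has)
    · exact Or.inl h
    · exact Or.inr h
  choose nx nx1 nx2 nx3 using step
  let f : ℕ → T := fun n => nx^[n] t
  have fs : ∀ n, f (n+1) = nx (f n) := fun n => Function.iterate_succ_apply' nx n t
  have fR1 : ∀ i k, R (f i) (f (i + k + 1)) := by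
    intro i k
    induction k with
    | zero => rw [Nat.add_zero, fs]; exact nx2 _
    | succ k ih => exact hRtr _ _ _ ih (by
        have := nx2 (f (i + k + 1))
        rw [← fs] at this; exact this)
  have fR : ∀ i j, i < j → R (f i) (f j) := by
    intro i j h
    obtain ⟨k, rfl⟩ := Nat.exists_eq_add_of_lt h
    exact fR1 i k
  refine (hh ℕ (fun a b => a < b) f fR ?_ 0).1 (h2 _ _)
  intro i s hs hr
  rcases (hRd _ _).1 hr with h | ⟨h, h'⟩
  · by_contra hcon
    push Not at hcon
    have below : ∀ k, lt (f (i + k)) s := by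
      intro k
      induction k with
      | zero => exact h
      | succ k ih =>
        rcases nx3 (f (i+k)) s (Or.inr hs) ((hRd _ _).2 (Or.inl ih)) with e1 | e1
        · exact absurd (by rw [show i + (k+1) = (i+k) + 1 by omega, fs]; exact e1.symm) (hcon (i+(k+1)) (by omega))
        · rw [show i + (k+1) = (i+k) + 1 by omega, fs]; exact e1
    have strict : ∀ k l, k < l → lt (f (i+k)) (f (i+l)) := by
      intro k l hkl
      rcases (hRd _ _).1 (fR (i+k) (i+l) (by omega)) with h | ⟨h, -⟩
      · exact h
      · have := below k
        rw [h] at this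
        exact absurd this (hmax _)
    let g : ℕ → S := fun k => ⟨f (i+k+1), by rw [fs]; exact nx1 _⟩
    obtain ⟨a, b, hab, e1⟩ := Finite.exists_ne_map_eq_of_infinite g
    have e2 : f (i+a+1) = f (i+b+1) := congrArg Subtype.val e1
    rcases lt_or_gt_of_ne hab with h | h
    · have := strict (a+1) (b+1) (by omega)
      rw [show i+(a+1) = i+a+1 by omega, show i+(b+1) = i+b+1 by omega, e2] at this
      exact hlt.1 _ this
    · have := strict (b+1) (a+1) (by omega)
      rw [show i+(a+1) = i+a+1 by omega, show i+(b+1) = i+b+1 by omega, e2] at this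
      exact hlt.1 _ this
  · refine ⟨i+1, by omega, ?_⟩
    rw [fs, h, h']
    rcases (hRd _ _).1 (nx2 e) with h3 | h3
    · exact absurd h3 (hmax _)
    · exact h3.2

theorem gen_contains (hA : ClosedA R A) {L1 : Set BForm} (h : L1 ⊆ genLogic R A) :
    Commutator L1 DiffLogic ⊆ genLogic R A := by
  intro ψ hψ
  exact hψ _ ⟨gen_isLogic hA, h, gen_diff, gen_comm1, gen_comm2, gen_comm3⟩

end gen



inductive Col : Type
  | a : ℕ → Col
  | b : ℕ → Col
  | q : ℕ → Col
  | e : Col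

inductive Row : Type
  | L : ℕ → Row
  | R : ℕ → Row

/-- The order: all `a`s, then the reversed `b`s, then the reversed `q`s, then `e`. -/
def clt : Col → Col → Prop
  | .a n, .a m => n < m
  | .a _, .b _ => True
  | .a _, .q _ => True
  | .a _, .e => True
  | .b _, .a _ => False
  | .b n, .b m => m < n
  | .b _, .q _ => True
  | .b _, .e => True
  | .q _, .a _ => False
  | .q _, .b _ => False
  | .q n, .q m => m < n
  | .q _, .e => True
  | .e, .a _ => False
  | .e, .b _ => False
  | .e, .q _ => False
  | .e, .e => False

def lam : Row → ℤ
  | .L m => 4 * m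
  | .R m => 4 * m + 2

def s1 (K : ℕ) : Col → Row → ℤ
  | .a n, .L m => max (-3) (min K (2 * m - n))
  | .a _, .R _ => K
  | .b _, .L _ => -3
  | .b n, .R m => max (-3) (min K (n - 2 * m))
  | .q _, .L _ => -3
  | .q _, .R _ => -3
  | .e, .L _ => -3
  | .e, .R _ => -3

def s2 (K : ℕ) : Col → Row → ℤ
  | .a _, _ => K
  | .b _, _ => K
  | .q n, v => max (-1) (min K (n - lam v))
  | .e, _ => -1

def gnr (K n m : ℕ) : Prop := K ≤ n ∧ K ≤ m ∧ n % 2 = m % 2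

def colE (K : ℕ) : Col → Col → Prop
  | .a n, .a m => n = m ∨ gnr K n m
  | .a n, .b m => gnr K n m
  | .a _, .q _ => False
  | .a _, .e => False
  | .b n, .a m => gnr K n m
  | .b n, .b m => n = m ∨ gnr K n m
  | .b _, .q _ => False
  | .b _, .e => False
  | .q _, .a _ => False
  | .q _, .b _ => False
  | .q n, .q m => n = m ∨ gnr K n m
  | .q _, .e => False
  | .e, .a _ => False
  | .e, .b _ => False
  | .e, .q _ => False
  | .e, .e => True

def rowE (K : ℕ) : Row → Row → Prop
  | .L n, .L m => n = m ∨ (K ≤ n ∧ K ≤ m)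
  | .L n, .R m => K ≤ n ∧ K ≤ m
  | .R n, .L m => K ≤ n ∧ K ≤ m
  | .R n, .R m => n = m ∨ (K ≤ n ∧ K ≤ m)

def EE (K : ℕ) (x y : Col × Row) : Prop :=
  colE K x.1 y.1 ∧ rowE K x.2 y.2 ∧ s1 K x.1 x.2 = s1 K y.1 y.2 ∧ s2 K x.1 x.2 = s2 K y.1 y.2

theorem EE_symm {K : ℕ} {x y : Col × Row} (h : EE K x y) : EE K y x := by
  obtain ⟨t, v⟩ := x
  obtain ⟨u, v2⟩ := y
  obtain ⟨h1, h2, h3, h4⟩ := h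
  refine ⟨?_, ?_, h3.symm, h4.symm⟩
  · cases t <;> cases u <;> simp only [colE, gnr] at h1 ⊢ <;> omega
  · cases v <;> cases v2 <;> simp only [rowE] at h2 ⊢ <;> omega

theorem EE_refl (K : ℕ) (x : Col × Row) : EE K x x := by
  obtain ⟨t, v⟩ := x
  refine ⟨?_, ?_, rfl, rfl⟩
  · cases t <;> simp only [colE, true_or]
  · cases v <;> simp only [rowE, true_or]

theorem EE_mono {K k : ℕ} (hk : k ≤ K) {x y : Col × Row} (h : EE K x y) : EE k x y := by
  obtain ⟨t, v⟩ := x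
  obtain ⟨u, v2⟩ := y
  obtain ⟨h1, h2, h3, h4⟩ := h
  simp only at h1 h2 h3 h4
  refine ⟨?_, ?_, ?_, ?_⟩ <;> simp only
  · cases t <;> cases u <;> simp only [colE, gnr] at h1 ⊢ <;> omega
  · cases v <;> cases v2 <;> simp only [rowE] at h2 ⊢ <;> omega
  · cases t <;> cases u <;> simp only [colE] at h1 <;> cases v <;> cases v2 <;>
      simp only [s1] at h3 ⊢ <;> omega
  · cases t <;> cases u <;> simp only [colE] at h1 <;>
      simp only [s2] at h4 ⊢ <;> omega

theorem clt_lin : IsLin clt := by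
  refine ⟨?_, ?_, ?_⟩
  · intro x; cases x <;> simp only [clt, lt_irrefl, not_false_eq_true]
  · intro x y z h1 h2
    cases x <;> cases y <;> simp only [clt] at h1 <;> cases z <;> simp only [clt] at h2 ⊢ <;> try omega
  · intro x y
    cases x <;> cases y <;> simp only [clt, Col.a.injEq, Col.b.injEq, Col.q.injEq, true_or, or_true, reduceCtorEq] <;> omega

theorem clt_e (t : Col) : ¬ clt .e t := by
  cases t <;> simp only [clt, not_false_eq_true]

theorem clt_to_e (t : Col) : clt t .e ∨ t = .e := by
  cases t <;> simp [clt]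

/-- Horizontal step. -/
theorem step0 (K K' : ℕ) (hK : 6 * K + 20 ≤ K') (t u t' : Col) (v v2 : Row)
    (h : EE K' (t, v) (u, v2)) (hlt : clt t t') : ∃ u', clt u u' ∧ EE K (t', v) (u', v2) := by
  obtain ⟨h1, h2, h3, h4⟩ := h
  simp only at h1 h2 h3 h4
  have hrow : rowE K v v2 := by
    cases v <;> cases v2 <;> simp only [rowE] at h2 ⊢ <;> omega
  cases t' with
  | e =>
    refine ⟨.e, ?_, ?_, hrow, ?_, ?_⟩
    · cases u <;> simp only [clt]
      cases t <;> simp only [colE, clt] at h1 hlt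
    · simp only [colE]
    · cases v <;> cases v2 <;> simp only [s1]
    · simp only [s2]
  | q n =>
    have hs1 : ∀ k, s1 K (.q n) v = s1 K (.q k) v2 := by
      intro k; cases v <;> cases v2 <;> simp only [s1]
    by_cases c1 : n < K
    · refine ⟨.q n, ?_, ?_, hrow, hs1 _, ?_⟩
      · cases t <;> cases u <;> simp only [colE, clt, gnr] at h1 hlt ⊢ <;> omega
      · simp only [colE, true_or]
      · cases v <;> cases v2 <;> simp only [rowE] at h2 <;> simp only [s2, lam] <;> omega
    · by_cases c2 : (n : ℤ) < lam v
      · refine ⟨.q (K + (n - K) % 2), ?_, ?_, hrow, hs1 _, ?_⟩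
        · cases t <;> cases u <;> simp only [colE, clt, gnr] at h1 hlt ⊢ <;> omega
        · simp only [colE, gnr]; omega
        · cases v <;> cases v2 <;> simp only [rowE] at h2 <;> simp only [s2, lam] at c2 ⊢ <;> omega
      · obtain ⟨σ, hσ⟩ : ∃ σ : ℕ, (((n : ℤ) - lam v = σ ∧ σ < K) ∨
            ((K : ℤ) ≤ (n : ℤ) - lam v ∧ (σ = K ∨ σ = K + 1) ∧ σ ≤ (n : ℤ) - lam v)) ∧
            (n + σ) % 2 = 0 := by
          have hl : lam v % 2 = 0 := by cases v <;> simp only [lam] <;> omega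
          by_cases c3 : (n : ℤ) - lam v < K
          · exact ⟨((n : ℤ) - lam v).toNat, by omega⟩
          · exact ⟨K + (n + K) % 2, by omega⟩
        obtain ⟨k, hk⟩ : ∃ k : ℕ, (k : ℤ) = lam v2 + σ := by
          refine ⟨(lam v2 + σ).toNat, ?_⟩
          cases v2 <;> simp only [lam] <;> omega
        refine ⟨.q k, ?_, ?_, hrow, hs1 _, ?_⟩
        · cases t <;> cases u <;> simp only [colE, clt, gnr] at h1 hlt ⊢ <;>
            simp only [s2] at h4 <;> omega
        · simp only [colE, gnr]
          cases v <;> cases v2 <;> simp only [rowE] at h2 <;> simp only [lam] at hk hσ c2 <;> omega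
        · cases v <;> cases v2 <;> simp only [rowE] at h2 <;> simp only [s2, lam] at hk hσ c2 ⊢ <;> omega
  | a n =>
    cases t with
    | b _ => exact hlt.elim
    | q _ => exact hlt.elim
    | e => exact hlt.elim
    | a n0 =>
      simp only [clt] at hlt
      by_cases c1 : n < K
      · refine ⟨.a n, ?_, ?_, hrow, ?_, ?_⟩
        · cases u <;> simp only [colE, clt, gnr] at h1 ⊢ <;> omega
        · simp only [colE, true_or]
        · cases v <;> cases v2 <;> simp only [rowE] at h2 <;> simp only [s1] <;> omega
        · simp only [s2]
      · by_cases c2 : s1 K (.a n) v = -3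
        · refine ⟨.b (K + (n - K) % 2), ?_, ?_, hrow, ?_, ?_⟩
          · cases u <;> simp only [colE, clt, gnr] at h1 ⊢ <;> omega
          · simp only [colE, gnr]; omega
          · cases v <;> cases v2 <;> simp only [rowE] at h2 <;> simp only [s1] at c2 ⊢ <;> omega
          · simp only [s2]
        · obtain ⟨σ, hσ⟩ : ∃ σ : ℤ, ((s1 K (.a n) v = σ ∧ σ < K) ∨
              (s1 K (.a n) v = K ∧ (σ = K ∨ σ = K + 1))) ∧ (n + σ) % 2 = 0 := by
            by_cases c3 : s1 K (.a n) v < K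
            · refine ⟨s1 K (.a n) v, Or.inl ⟨rfl, c3⟩, ?_⟩
              cases v <;> simp only [s1] at c2 c3 ⊢ <;> omega
            · refine ⟨K + (n + K) % 2, Or.inr ⟨?_, by omega⟩, by omega⟩
              cases v <;> simp only [s1] at c3 ⊢ <;> omega
          cases v2 with
          | L m2 =>
            obtain ⟨k, hk⟩ : ∃ k : ℕ, (k : ℤ) = 2 * m2 - σ := by
              refine ⟨(2 * (m2 : ℤ) - σ).toNat, ?_⟩
              cases v <;> simp only [rowE] at h2 <;> simp only [s1] at c2 hσ <;> omega
            refine ⟨.a k, ?_, ?_, hrow, ?_, ?_⟩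
            · cases u <;> simp only [colE, clt, gnr] at h1 ⊢ <;> cases v <;>
                simp only [rowE] at h2 <;> simp only [s1] at c2 hσ h3 <;> omega
            · cases v <;> simp only [rowE] at h2 <;> simp only [s1, colE, gnr] at c2 hσ ⊢ <;> omega
            · cases v <;> simp only [rowE] at h2 <;> simp only [s1] at c2 hσ ⊢ <;> omega
            · simp only [s2]
          | R m2 =>
            obtain ⟨k, hk⟩ : ∃ k : ℕ, (k : ℤ) = 2 * m2 + σ := by
              refine ⟨(2 * (m2 : ℤ) + σ).toNat, ?_⟩
              cases v <;> simp only [rowE] at h2 <;> simp only [s1] at c2 hσ <;> omega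
            refine ⟨.b k, ?_, ?_, hrow, ?_, ?_⟩
            · cases u <;> simp only [colE, clt, gnr] at h1 ⊢ <;> cases v <;>
                simp only [rowE] at h2 <;> simp only [s1] at c2 hσ h3 <;> omega
            · cases v <;> simp only [rowE] at h2 <;> simp only [s1, colE, gnr] at c2 hσ ⊢ <;> omega
            · cases v <;> simp only [rowE] at h2 <;> simp only [s1] at c2 hσ ⊢ <;> omega
            · simp only [s2]
  | b n =>
    by_cases c1 : n < K
    · refine ⟨.b n, ?_, ?_, hrow, ?_, ?_⟩
      · cases t <;> cases u <;> simp only [colE, clt, gnr] at h1 hlt ⊢ <;> omega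
      · simp only [colE, true_or]
      · cases v <;> cases v2 <;> simp only [rowE] at h2 <;> simp only [s1] <;> omega
      · simp only [s2]
    · by_cases c2 : s1 K (.b n) v = -3
      · refine ⟨.b (K + (n - K) % 2), ?_, ?_, hrow, ?_, ?_⟩
        · cases t <;> cases u <;> simp only [colE, clt, gnr] at h1 hlt ⊢ <;> omega
        · simp only [colE, gnr]; omega
        · cases v <;> cases v2 <;> simp only [rowE] at h2 <;> simp only [s1] at c2 ⊢ <;> omega
        · simp only [s2]
      · obtain ⟨σ, hσ⟩ : ∃ σ : ℤ, ((s1 K (.b n) v = σ ∧ σ < K) ∨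
            (s1 K (.b n) v = K ∧ (σ = K ∨ σ = K + 1))) ∧ (n + σ) % 2 = 0 := by
          by_cases c3 : s1 K (.b n) v < K
          · refine ⟨s1 K (.b n) v, Or.inl ⟨rfl, c3⟩, ?_⟩
            cases v
            · exact absurd rfl c2
            · simp only [s1] at c2 c3 ⊢; omega
          · refine ⟨K + (n + K) % 2, Or.inr ⟨?_, by omega⟩, by omega⟩
            cases v
            · exact absurd rfl c2
            · simp only [s1] at c2 c3 ⊢; omega
        cases v with
        | L m => exact absurd rfl c2
        | R m =>
        cases v2 with
        | L m2 =>
          simp only [rowE] at h2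
          obtain ⟨k, hk⟩ : ∃ k : ℕ, (k : ℤ) = 2 * m2 - σ := by
            refine ⟨(2 * (m2 : ℤ) - σ).toNat, ?_⟩
            simp only [s1] at c2 hσ; omega
          refine ⟨.a k, ?_, ?_, hrow, ?_, ?_⟩
          · cases t <;> cases u <;> simp only [colE, clt, gnr] at h1 hlt ⊢ <;>
              simp only [s1] at c2 hσ h3 <;> omega
          · simp only [s1, colE, gnr] at c2 hσ ⊢; omega
          · simp only [s1] at c2 hσ ⊢; omega
          · simp only [s2]
        | R m2 =>
          simp only [rowE] at h2
          obtain ⟨k, hk⟩ : ∃ k : ℕ, (k : ℤ) = 2 * m2 + σ := by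
            refine ⟨(2 * (m2 : ℤ) + σ).toNat, ?_⟩
            simp only [s1] at c2 hσ; omega
          refine ⟨.b k, ?_, ?_, hrow, ?_, ?_⟩
          · cases t <;> cases u <;> simp only [colE, clt, gnr] at h1 hlt ⊢ <;>
              simp only [s1] at c2 hσ h3 <;> omega
          · simp only [s1, colE, gnr] at c2 hσ ⊢; omega
          · simp only [s1] at c2 hσ ⊢; omega
          · simp only [s2]



theorem lamL (m : ℕ) : lam (.L m) = 4 * m := rfl
theorem lamR (m : ℕ) : lam (.R m) = 4 * m + 2 := rfl

def rowIx : Row → ℕ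
  | .L m => m
  | .R m => m

/-- Vertical step. -/
theorem step1 (K K' : ℕ) (hK : 6 * K + 20 ≤ K') (t u : Col) (v v2 v' : Row)
    (h : EE K' (t, v) (u, v2)) (hne : v ≠ v') : ∃ v2', v2 ≠ v2' ∧ EE K (t, v') (u, v2') := by
  by_cases htu : t = u
  · subst htu
    by_cases hv : v' = v2
    · subst hv
      exact ⟨v, hne.symm, EE_mono (by omega) (EE_symm h)⟩
    · exact ⟨v', fun e => hv e.symm, EE_refl _ _⟩
  obtain ⟨h1, h2, h3, h4⟩ := h
  simp only at h1 h2 h3 h4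
  have hcol : colE K t u := by
    cases t <;> cases u <;> simp only [colE, gnr] at h1 ⊢ <;> omega
  by_cases hex : rowIx v' < K
  · refine ⟨v', ?_, hcol, ?_, ?_, ?_⟩
    · rintro rfl
      cases v <;> cases v2 <;> simp only [rowIx] at hex <;> simp only [rowE] at h2
      · apply hne; congr 1; omega
      · omega
      · omega
      · apply hne; congr 1; omega
    · cases v' <;> simp only [rowE, true_or]
    · cases t <;> cases u <;>
        simp only [colE, gnr, Col.a.injEq, Col.b.injEq, Col.q.injEq, reduceCtorEq] at h1 htu <;>
        cases v' <;> simp only [rowIx] at hex <;> simp only [s1] <;> omega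
    · cases t <;> cases u <;>
        simp only [colE, gnr, Col.a.injEq, Col.b.injEq, Col.q.injEq, reduceCtorEq] at h1 htu <;>
        cases v' <;> simp only [rowIx] at hex <;> simp only [s2, lam] <;> omega
  have hgr : ∀ v2', K ≤ rowIx v2' → rowE K v' v2' := by
    intro v2' hv2'
    cases v' <;> cases v2' <;> simp only [rowIx, rowE] at hex hv2' ⊢ <;> omega
  have hneq : ∀ x y : Row, x ≠ y → ∃ z, (z = x ∨ z = y) ∧ v2 ≠ z := by
    intro x y hxy
    by_cases e : v2 = x
    · exact ⟨y, Or.inr rfl, fun e' => hxy (e.symm.trans e')⟩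
    · exact ⟨x, Or.inl rfl, e⟩
  -- the two kinds of columns
  by_cases hq : ∃ n, t = .q n
  · obtain ⟨n, rfl⟩ := hq
    cases u with
    | a _ => exact h1.elim
    | b _ => exact h1.elim
    | e => exact h1.elim
    | q n2 =>
      simp only [colE, gnr, Col.q.injEq] at h1 htu
      have hs1 : ∀ w, s1 K (.q n) v' = s1 K (.q n2) w := by
        intro w; cases v' <;> cases w <;> rfl
      by_cases c1 : (n : ℤ) < lam v'
      · obtain ⟨z, hz, hvz⟩ := hneq (.L (n2+1)) (.L (n2+2)) (by simp)
        refine ⟨z, hvz, hcol, hgr _ ?_, hs1 _, ?_⟩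
        · rcases hz with rfl | rfl <;> simp only [rowIx] <;> omega
        · rcases hz with rfl | rfl <;> simp only [s2] <;> simp only [lam] <;>
            simp only [lam] at c1 <;> omega
      · by_cases c2 : (n : ℤ) - lam v' < K
        · obtain ⟨z, hz⟩ : ∃ z, lam z = n2 - (n - lam v') := by
            have he : lam v' % 2 = 0 := by cases v' <;> simp only [lam] <;> omega
            by_cases c3 : ((n2 : ℤ) - (n - lam v')) % 4 = 0
            · refine ⟨.L (((n2 : ℤ) - (n - lam v')) / 4).toNat, ?_⟩
              simp only [lamL, lamR]; omega
            · refine ⟨.R (((n2 : ℤ) - (n - lam v')) / 4).toNat, ?_⟩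
              simp only [lamL, lamR]; omega
          refine ⟨z, ?_, hcol, hgr _ ?_, hs1 _, ?_⟩
          · rintro rfl
            simp only [s2] at h4
            have hl : lam v = lam v' := by omega
            apply hne
            cases v <;> cases v' <;> simp only [lam] at hl
            · congr 1; omega
            · omega
            · omega
            · congr 1; omega
          · cases z <;> simp only [rowIx] <;> simp only [lamL, lamR] at hz <;> omega
          · simp only [s2]; omega
        · obtain ⟨z, hz, hvz⟩ := hneq (.L K) (.L (K+1)) (by simp)
          refine ⟨z, hvz, hcol, hgr _ ?_, hs1 _, ?_⟩
          · rcases hz with rfl | rfl <;> simp only [rowIx] <;> omega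
          · simp only [s2]
            have : max (-1) (min (K : ℤ) (n - lam v')) = K := by omega
            rw [this]
            rcases hz with rfl | rfl <;> simp only [lam] <;> omega
  · have hs2 : ∀ w, s2 K t v' = s2 K u w := by
      intro w
      cases t <;> cases u <;> simp only [colE] at h1 <;> first | rfl | exact absurd ⟨_, rfl⟩ hq
    by_cases c1 : s1 K t v' = -3
    · obtain ⟨z, hz, hvz⟩ := hneq (.L K) (.L (K+1)) (by simp)
      refine ⟨z, hvz, hcol, hgr _ ?_, ?_, hs2 _⟩
      · rcases hz with rfl | rfl <;> simp only [rowIx] <;> omega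
      · rw [c1]
        cases t <;> cases u <;>
          simp only [colE, gnr, Col.a.injEq, Col.b.injEq, Col.q.injEq, reduceCtorEq] at h1 htu <;>
          first
          | exact absurd ⟨_, rfl⟩ hq
          | (rcases hz with rfl | rfl <;> simp only [s1] <;> omega)
    · by_cases c2 : s1 K t v' < K
      · cases t with
        | q n => exact absurd ⟨_, rfl⟩ hq
        | e => cases v' <;> exact absurd rfl c1
        | a n =>
          cases v' with
          | R m => simp only [s1] at c2; omega
          | L m =>
            cases u with
            | q _ => exact h1.elim
            | e => exact h1.elim
            | a n2 =>
              simp only [colE, gnr, Col.a.injEq] at h1 htu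
              simp only [s1] at c1 c2
              obtain ⟨k, hk⟩ : ∃ k : ℕ, (2 * k : ℤ) = n2 + (2 * m - n) :=
                ⟨(((n2 : ℤ) + (2 * m - n)) / 2).toNat, by omega⟩
              refine ⟨.L k, ?_, hcol, hgr _ ?_, ?_, hs2 _⟩
              · rintro rfl
                cases v <;> simp only [s1, Row.L.injEq, ne_eq] at h3 hne <;> omega
              · simp only [rowIx]; omega
              · simp only [s1]; omega
            | b n2 =>
              simp only [colE, gnr] at h1
              simp only [s1] at c1 c2
              obtain ⟨k, hk⟩ : ∃ k : ℕ, (2 * k : ℤ) = n2 - (2 * m - n) :=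
                ⟨(((n2 : ℤ) - (2 * m - n)) / 2).toNat, by omega⟩
              refine ⟨.R k, ?_, hcol, hgr _ ?_, ?_, hs2 _⟩
              · rintro rfl
                cases v <;> simp only [s1, Row.L.injEq, ne_eq] at h3 hne <;> omega
              · simp only [rowIx]; omega
              · simp only [s1]; omega
        | b n =>
          cases v' with
          | L m => exact absurd rfl c1
          | R m =>
            cases u with
            | q _ => exact h1.elim
            | e => exact h1.elim
            | a n2 =>
              simp only [colE, gnr] at h1
              simp only [s1] at c1 c2
              obtain ⟨k, hk⟩ : ∃ k : ℕ, (2 * k : ℤ) = n2 + (n - 2 * m) :=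
                ⟨(((n2 : ℤ) + (n - 2 * m)) / 2).toNat, by omega⟩
              refine ⟨.L k, ?_, hcol, hgr _ ?_, ?_, hs2 _⟩
              · rintro rfl
                cases v <;> simp only [s1, Row.R.injEq, ne_eq] at h3 hne <;> omega
              · simp only [rowIx]; omega
              · simp only [s1]; omega
            | b n2 =>
              simp only [colE, gnr, Col.b.injEq] at h1 htu
              simp only [s1] at c1 c2
              obtain ⟨k, hk⟩ : ∃ k : ℕ, (2 * k : ℤ) = n2 - (n - 2 * m) :=
                ⟨(((n2 : ℤ) - (n - 2 * m)) / 2).toNat, by omega⟩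
              refine ⟨.R k, ?_, hcol, hgr _ ?_, ?_, hs2 _⟩
              · rintro rfl
                cases v <;> simp only [s1, Row.R.injEq, ne_eq] at h3 hne <;> omega
              · simp only [rowIx]; omega
              · simp only [s1]; omega
      · have c3 : s1 K t v' = K := by
          cases t <;> cases v' <;> simp only [s1] at c1 c2 ⊢ <;> omega
        obtain ⟨z, hz, hvz⟩ := hneq (.R K) (.R (K+1)) (by simp)
        refine ⟨z, hvz, hcol, hgr _ ?_, ?_, hs2 _⟩
        · rcases hz with rfl | rfl <;> simp only [rowIx] <;> omega
        · rw [c3]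
          cases t <;> cases u <;>
            simp only [colE, gnr, Col.a.injEq, Col.b.injEq, Col.q.injEq, reduceCtorEq] at h1 htu <;>
            first
            | exact absurd ⟨_, rfl⟩ hq
            | (rcases hz with rfl | rfl <;> simp only [s1] <;> omega)
            | exact absurd trivial htu

/-- The admissible sets. -/
def Adm (X : Col × Row → Prop) : Prop :=
  ∃ K0, ∀ K, K0 ≤ K → ∀ x y, EE K x y → (X x ↔ X y)

/-- The horizontal relation (`rf` : the last point is reflexive). -/
def cR (rf : Prop) (t u : Col) : Prop := clt t u ∨ (rf ∧ t = .e ∧ u = .e)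

theorem adm_of {X : Col × Row → Prop} (K0 : ℕ)
    (h : ∀ K, K0 ≤ K → ∀ x y, EE K x y → X x → X y) : Adm X :=
  ⟨K0, fun K hK x y hxy => ⟨h K hK x y hxy, h K hK y x (EE_symm hxy)⟩⟩

theorem adm_closed (rf : Prop) : ClosedA (cR rf) Adm where
  neg := by
    rintro X ⟨K0, h⟩
    exact ⟨K0, fun K hK x y hxy => not_congr (h K hK x y hxy)⟩
  and := by
    rintro X Y ⟨K0, h⟩ ⟨K1, h'⟩
    exact ⟨max K0 K1, fun K hK x y hxy => and_congr (h K (le_trans (le_max_left _ _) hK) x y hxy)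
      (h' K (le_trans (le_max_right _ _) hK) x y hxy)⟩
  dia0 := by
    rintro X ⟨K0, h⟩
    refine adm_of (6 * K0 + 20) ?_
    rintro K hK ⟨t, v⟩ ⟨u, v2⟩ hxy ⟨⟨t', v'⟩, ⟨hr, e⟩, hX⟩
    simp only at hr e
    subst e
    rcases hr with hr | ⟨hrf, rfl, rfl⟩
    · obtain ⟨u', h1, h2⟩ := step0 K0 K hK t u t' v v2 hxy hr
      exact ⟨(u', v2), ⟨Or.inl h1, rfl⟩, (h K0 le_rfl _ _ h2).1 hX⟩
    · have : u = .e := by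
        have := hxy.1
        cases u <;> simp only [colE] at this
        rfl
      subst this
      exact ⟨(.e, v2), ⟨Or.inr ⟨hrf, rfl, rfl⟩, rfl⟩, (h K0 le_rfl _ _ (EE_mono (by omega) hxy)).1 hX⟩
  dia1 := by
    rintro X ⟨K0, h⟩
    refine adm_of (6 * K0 + 20) ?_
    rintro K hK ⟨t, v⟩ ⟨u, v2⟩ hxy ⟨⟨t', v'⟩, ⟨e, hr⟩, hX⟩
    simp only at hr e
    subst e
    obtain ⟨v2', h1, h2⟩ := step1 K0 K hK t u v v2 v' hxy hr
    exact ⟨(u, v2'), ⟨rfl, h1⟩, (h K0 le_rfl _ _ h2).1 hX⟩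

theorem adm_max : MaxProp clt Adm := by
  classical
  rintro X ⟨K, hX⟩ v t ht
  by_cases he : X (.e, v)
  · exact ⟨.e, he, fun s _ => (clt_to_e s).symm⟩
  by_cases hq : ∃ n, X (.q n, v)
  · refine ⟨.q (Nat.find hq), Nat.find_spec hq, ?_⟩
    intro s hs
    cases s with
    | a n => exact Or.inr trivial
    | b n => exact Or.inr trivial
    | q n =>
      rcases (Nat.find_min' hq hs).lt_or_eq with h | h
      · exact Or.inr h
      · exact Or.inl (by rw [h])
    | e => exact absurd hs he
  by_cases hb : ∃ n, X (.b n, v)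
  · refine ⟨.b (Nat.find hb), Nat.find_spec hb, ?_⟩
    intro s hs
    cases s with
    | a n => exact Or.inr trivial
    | b n =>
      rcases (Nat.find_min' hb hs).lt_or_eq with h | h
      · exact Or.inr h
      · exact Or.inl (by rw [h])
    | q n => exact absurd ⟨n, hs⟩ hq
    | e => exact absurd hs he
  have hbd : ∀ n, X (.a n, v) → n < K + 2 * rowIx v + 4 := by
    intro n hn
    by_contra hc
    apply hb
    refine ⟨n + 2 * rowIx v + 2 * K, (hX K le_rfl (.a n, v) _ ?_).1 hn⟩
    refine ⟨?_, (EE_refl K (.a n, v)).2.1, ?_, ?_⟩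
    · simp only [colE, gnr]; omega
    · cases v <;> simp only [s1, rowIx] at hc ⊢ <;> omega
    · rfl
  have ha : ∃ n, X (.a n, v) := by
    cases t with
    | a n => exact ⟨n, ht⟩
    | b n => exact absurd ⟨n, ht⟩ hb
    | q n => exact absurd ⟨n, ht⟩ hq
    | e => exact absurd ht he
  obtain ⟨n0, hn0⟩ := ha
  let B := K + 2 * rowIx v + 4
  have hspec : X (.a (Nat.findGreatest (fun n => X (.a n, v)) B), v) :=
    Nat.findGreatest_spec (P := fun n => X (.a n, v)) (hbd n0 hn0).le hn0
  refine ⟨_, hspec, ?_⟩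
  intro s hs
  cases s with
  | a n =>
    have := Nat.le_findGreatest (P := fun n => X (.a n, v)) (n := B) (hbd n hs).le hs
    rcases this.lt_or_eq with h | h
    · exact Or.inr h
    · exact Or.inl (by rw [← h])
  | b n => exact absurd ⟨n, hs⟩ hb
  | q n => exact absurd ⟨n, hs⟩ hq
  | e => exact absurd hs he

def mval : ℕ → Col × Row → Prop
  | 0, x => s1 3 x.1 x.2 = 0
  | 1, x => s1 3 x.1 x.2 = -2
  | 2, x => s2 3 x.1 x.2 = 0
  | _, _ => False

theorem mval_adm : ∀ i, Adm (mval i) := by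
  intro i
  refine adm_of 3 ?_
  intro K hK x y hxy
  have h := EE_mono hK hxy
  match i with
  | 0 => exact fun hx => h.2.2.1.symm.trans hx
  | 1 => exact fun hx => h.2.2.1.symm.trans hx
  | 2 => exact fun hx => h.2.2.2.symm.trans hx
  | (n+3) => exact fun hx => hx.elim



def evAB : Col → Prop
  | .a n => n % 2 = 0
  | .b n => n % 2 = 0
  | .q _ => False
  | .e => False

def evQ : Col → Prop
  | .a _ => False
  | .b _ => False
  | .q n => n % 2 = 0
  | .e => False

theorem mP (t : Col) (v : Row) :
    (∃ y, ((t, v) = y ∨ prodR1 (fun a b : Row => a ≠ b) (t, v) y) ∧ mval 0 y) ↔ evAB t := by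
  have h1 : (∃ y, ((t, v) = y ∨ prodR1 (fun a b : Row => a ≠ b) (t, v) y) ∧ mval 0 y) ↔
      ∃ v', s1 3 t v' = 0 := by
    constructor
    · rintro ⟨⟨t', v'⟩, h | ⟨h, _⟩, hm⟩
      · cases h; exact ⟨_, hm⟩
      · simp only at h; subst h; exact ⟨_, hm⟩
    · rintro ⟨v', h⟩
      by_cases e : v = v'
      · subst e; exact ⟨_, Or.inl rfl, h⟩
      · exact ⟨(t, v'), Or.inr ⟨rfl, e⟩, h⟩
  rw [h1]
  constructor
  · rintro ⟨v', h⟩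
    cases t <;> cases v' <;> simp only [s1, evAB] at h ⊢ <;> omega
  · intro h
    cases t with
    | a n => exact ⟨.L (n / 2), by simp only [evAB] at h; simp only [s1]; omega⟩
    | b n => exact ⟨.R (n / 2), by simp only [evAB] at h; simp only [s1]; omega⟩
    | q n => exact h.elim
    | e => exact h.elim

theorem mL (t : Col) (v : Row) :
    (∃ y, ((t, v) = y ∨ prodR1 (fun a b : Row => a ≠ b) (t, v) y) ∧ mval 2 y) ↔ evQ t := by
  have h1 : (∃ y, ((t, v) = y ∨ prodR1 (fun a b : Row => a ≠ b) (t, v) y) ∧ mval 2 y) ↔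
      ∃ v', s2 3 t v' = 0 := by
    constructor
    · rintro ⟨⟨t', v'⟩, h | ⟨h, _⟩, hm⟩
      · cases h; exact ⟨_, hm⟩
      · simp only at h; subst h; exact ⟨_, hm⟩
    · rintro ⟨v', h⟩
      by_cases e : v = v'
      · subst e; exact ⟨_, Or.inl rfl, h⟩
      · exact ⟨(t, v'), Or.inr ⟨rfl, e⟩, h⟩
  rw [h1]
  constructor
  · rintro ⟨v', h⟩
    cases t <;> cases v' <;> simp only [s2, evQ, lam] at h ⊢ <;> omega
  · intro h
    cases t with
    | a n => exact h.elim
    | b n => exact h.elim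
    | q n =>
      simp only [evQ] at h
      by_cases c : n % 4 = 0
      · exact ⟨.L (n / 4), by simp only [s2, lam]; omega⟩
      · exact ⟨.R (n / 4), by simp only [s2, lam]; omega⟩
    | e => exact h.elim

theorem phi_true (rf : Prop) :
    BSat (prodR0 (cR rf)) (prodR1 (fun a b : Row => a ≠ b)) mval (.a 0, .L 0) phi := by
  have fPt : ∀ t v, BSat (prodR0 (cR rf)) (prodR1 (fun a b : Row => a ≠ b)) mval (t, v) fP ↔ evAB t :=
    fun t v => sat_diaP.trans (mP t v)
  have fLt : ∀ t v, BSat (prodR0 (cR rf)) (prodR1 (fun a b : Row => a ≠ b)) mval (t, v) fL ↔ evQ t :=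
    fun t v => sat_diaP.trans (mL t v)
  have ce : ∀ t, cR rf .e t → t = .e := by
    rintro t (h | h)
    · exact absurd h (clt_e _)
    · exact h.2.2
  simp only [phi, sat_and]
  refine ⟨?_, ?_, ?_, ?_, ?_, ?_, ?_, ?_, ?_⟩
  · rw [phiA, fPt]; rfl
  · rw [phiB, sat_dia0]
    exact ⟨(.q 0, .L 0), ⟨Or.inl trivial, rfl⟩, (fLt _ _).2 rfl⟩
  · rw [phiC, sat_dia0]
    refine ⟨(.e, .L 0), ⟨Or.inl trivial, rfl⟩, ?_⟩
    simp only [sat_and, sat_neg, sat_box0, fPt, fLt]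
    refine ⟨id, id, ?_, ?_⟩
    · rintro ⟨t, v⟩ ⟨h, _⟩
      have := ce _ h
      simp only at this
      subst this
      exact id
    · rintro ⟨t, v⟩ ⟨h, _⟩
      have := ce _ h
      simp only at this
      subst this
      exact id
  · rw [phiD, sat_fU]
    rintro ⟨t, v⟩ -
    simp only [sat_imp, sat_box1, sat_neg, sat_var]
    rintro h ⟨t', v'⟩ ⟨e, hv⟩ h'
    simp only at e hv
    subst e
    apply hv
    simp only [mval] at h h'
    cases t <;> cases v <;> cases v' <;> simp only [s1] at h h' <;> first | omega | (congr 1; omega)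
  · rw [phiE, sat_fU]
    rintro ⟨t, v⟩ -
    simp only [sat_imp, sat_box0, sat_neg, sat_var]
    rintro h ⟨t', v'⟩ ⟨hr, e⟩ h'
    simp only at hr e
    subst e
    simp only [mval] at h h'
    rcases hr with hr | ⟨-, rfl, rfl⟩
    · cases t <;> cases t' <;> simp only [clt] at hr <;> simp only [s2] at h h' <;> omega
    · simp only [s2] at h; omega
  · rw [phiF, sat_fU]
    rintro ⟨t, v⟩ -
    simp only [sat_imp, sat_and, sat_dia0, sat_neg, sat_var]
    rintro ⟨h, ⟨t', v'⟩, ⟨hr, e⟩, h'⟩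
    simp only at hr e
    rw [fPt] at h'
    subst e
    simp only [mval] at h
    cases t with
    | a n =>
      refine ⟨(.a (n+1), v), ⟨Or.inl (by simp only [clt]; omega), rfl⟩, ?_, (.a (n+2), v),
        ⟨Or.inl (by simp only [clt]; omega), rfl⟩, ?_, ?_⟩
      · rw [fPt]; cases v <;> simp only [s1, evAB] at h ⊢ <;> omega
      · cases v <;> simp only [s1, mval] at h ⊢ <;> omega
      · rw [fPt]; cases v <;> simp only [s1, evAB] at h ⊢ <;> omega
    | b n =>
      have hn : 2 ≤ n ∧ n % 2 = 0 := by
        rcases hr with hr | ⟨-, hr, -⟩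
        · cases v <;> simp only [s1] at h
          · omega
          · cases t' <;> simp only [evAB, clt] at h' hr
            omega
        · cases hr
      refine ⟨(.b (n-1), v), ⟨Or.inl (by simp only [clt]; omega), rfl⟩, ?_, (.b (n-2), v),
        ⟨Or.inl (by simp only [clt]; omega), rfl⟩, ?_, ?_⟩
      · rw [fPt]; simp only [evAB]; omega
      · cases v <;> simp only [s1, mval] at h ⊢ <;> omega
      · rw [fPt]; simp only [evAB]; omega
    | q n => cases v <;> simp only [s1] at h <;> omega
    | e => cases v <;> simp only [s1] at h <;> omega
  · rw [phiH, sat_fU]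
    rintro ⟨t, v⟩ -
    simp only [sat_imp, sat_dia0, sat_box0, sat_neg, sat_var]
    rintro h ⟨t', v'⟩ ⟨hr, e⟩ ⟨⟨t2, v2⟩, ⟨hr2, e2⟩, h2⟩
    simp only at hr e hr2 e2
    subst e e2
    rw [fPt]
    simp only [mval] at h h2
    rcases hr with hr | ⟨-, rfl, rfl⟩
    · rcases hr2 with hr2 | ⟨-, rfl, rfl⟩
      · intro h3
        cases t <;> cases t' <;> simp only [clt] at hr <;> cases t2 <;> simp only [clt] at hr2 <;>
          cases v <;> simp only [s1, evAB] at h h2 h3 <;> omega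
      · cases v <;> simp only [s1] at h2 <;> omega
    · exact id
  · rw [phiJ, sat_boxP1]
    rintro ⟨t, v⟩ ht
    have : t = .a 0 := by
      rcases ht with ht | ⟨ht, -⟩
      · cases ht; rfl
      · exact ht.symm
    subst this
    simp only [sat_imp, sat_dia0, sat_and, sat_neg, sat_var]
    rintro ⟨⟨t', v'⟩, ⟨hr, e⟩, h⟩
    simp only at hr e
    subst e
    simp only [mval] at h
    cases t' with
    | a n => simp only [s2] at h; omega
    | b n => simp only [s2] at h; omega
    | e => simp only [s2] at h; omega
    | q n =>
      have hn : n % 2 = 0 := by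
        cases v <;> simp only [s2, lam] at h <;> omega
      refine ⟨(.q (n+2), v), ⟨Or.inl trivial, rfl⟩, ?_, (.q (n+1), v),
        ⟨Or.inl (by simp only [clt]; omega), rfl⟩, ?_, (.q n, v),
        ⟨Or.inl (by simp only [clt]; omega), rfl⟩, h⟩
      · rw [fLt]; simp only [evQ]; omega
      · rw [fLt]; simp only [evQ]; omega
  · rw [phiK, sat_boxP1]
    rintro ⟨t, v⟩ ht
    have : t = .a 0 := by
      rcases ht with ht | ⟨ht, -⟩
      · cases ht; rfl
      · exact ht.symm
    subst this
    simp only [sat_imp, sat_dia0, sat_and, sat_or, sat_var]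
    rintro ⟨⟨t', v'⟩, ⟨hr, e⟩, h⟩
    simp only at hr e
    subst e
    have h0 := h
    simp only [mval] at h
    cases t' with
    | a n => simp only [s2] at h; omega
    | b n => simp only [s2] at h; omega
    | e => simp only [s2] at h; omega
    | q n =>
      cases v with
      | L m =>
        by_cases hm : m = 0
        · subst hm; exact Or.inl rfl
        · refine Or.inr ⟨(.a (2*m), .L m), ⟨Or.inl (by simp only [clt]; omega), rfl⟩, ?_,
            (.q n, .L m), ⟨Or.inl trivial, rfl⟩, h0⟩
          simp only [mval, s1]; omega
      | R m =>
        refine Or.inr ⟨(.b (2*m), .R m), ⟨Or.inl trivial, rfl⟩, ?_,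
          (.q n, .R m), ⟨Or.inl trivial, rfl⟩, h0⟩
        simp only [mval, s1]; omega

theorem comm_mono {L L' M : Set BForm} (h : L ⊆ L') : Commutator L M ⊆ Commutator L' M :=
  fun _ hψ K hK => hψ K ⟨hK.1, h.trans hK.2.1, hK.2.2⟩

theorem not_phi_GL3 : neg phi ∉ Commutator GL3 DiffLogic := by
  intro h
  have e : cR False = clt := by
    funext t u; simp [cR]
  have hA := adm_closed False
  have h1 : GL3 ⊆ genLogic (cR False) Adm := by
    refine gen_GL3 hA ?_ ?_
    · rw [e]; exact adm_max
    · rw [e]; exact clt_lin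
  exact gen_contains hA h1 h mval mval_adm (.a 0, .L 0) (phi_true False)

theorem not_phi_omega : neg phi ∉ Commutator LogOmega DiffLogic := by
  intro h
  have hA := adm_closed True
  have h1 : LogOmega ⊆ genLogic (cR True) Adm :=
    gen_omega .e clt_lin clt_e (fun a b => by simp [cR]) hA adm_max
  exact gen_contains hA h1 h mval mval_adm (.a 0, .L 0) (phi_true True)

/-- For `L₁` any of `Log⟨ω,<⟩`, `GL.3`, `DisK4.3`, the commutator
`[L₁,Diff]` is Kripke incomplete. -/
theorem commutator_kripke_incomplete (L1 : Set BForm)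
    (h1 : L1 = LogOmega ∨ L1 = GL3 ∨ L1 = DisK43) :
    ¬ KripkeComplete (Commutator L1 DiffLogic) := by
  rintro ⟨C, hC⟩
  have hsub : DisK43 ⊆ L1 := by
    rcases h1 with rfl | rfl | rfl
    · exact disK43_sub_omega
    · exact disK43_sub_GL3
    · exact le_rfl
  have hmem : neg phi ∈ Commutator L1 DiffLogic := by
    rw [hC]
    intro F hF
    apply kripke_unsat F
    intro ψ hψ
    have : ψ ∈ LogOf C := hC ▸ comm_mono hsub hψ
    exact this F hF
  rcases h1 with rfl | rfl | rfl
  · exact not_phi_omega hmem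
  · exact not_phi_GL3 hmem
  · exact not_phi_GL3 (comm_mono disK43_sub_GL3 hmem)


end HK
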